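/- arXiv:math/0310134 — 5 statements merged into one kernel-verified Lean document; each statement's English description precedes it below -/
import Mathlib

section
/- Let k be a field of characteristic 2 and G a finite group. Then the Loewy length of the group algebra kG is strictly greater than the 2-rank of G; that is, if G contains a subgroup isomorphic to (ℤ/2ℤ)^r, then J(kG)^r ≠ 0, where J(kG) is the Jacobson radical of kG. -/
universe u v
/-- Partial derivatives extend to the field of rational functions. -/
theorem exists_derivation_fractionRing (k : Type*) [Field k] {ι : Type*} [DecidableEq ι] (i : ι) :
    ∃ D : Derivation k (FractionRing (MvPolynomial ι k)) (FractionRing (MvPolynomial ι k)),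
      ∀ j, D (algebraMap (MvPolynomial ι k) _ (MvPolynomial.X j)) = if j = i then 1 else 0 := by
  set P := MvPolynomial ι k
  set K := FractionRing P
  let g : P →ₐ[k] DualNumber K := MvPolynomial.aeval fun j =>
    TrivSqZeroExt.inl (algebraMap P K (MvPolynomial.X j)) +
      TrivSqZeroExt.inr (if j = i then 1 else 0)
  have hgX : ∀ j, g (MvPolynomial.X j) = TrivSqZeroExt.inl (algebraMap P K (MvPolynomial.X j)) +
      TrivSqZeroExt.inr (if j = i then 1 else 0) := fun j => MvPolynomial.aeval_X _ _
  have hfst : ∀ p, (g p).fst = algebraMap P K p := by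
    intro p
    have : (TrivSqZeroExt.fstHom k K K).comp g = IsScalarTower.toAlgHom k P K := by
      refine MvPolynomial.algHom_ext fun j => ?_
      change (g (MvPolynomial.X j)).fst = algebraMap P K (MvPolynomial.X j)
      simp [hgX]
    exact DFunLike.congr_fun this p
  have hg : ∀ y : nonZeroDivisors P, IsUnit (g y) := fun y => by
    rw [TrivSqZeroExt.isUnit_iff_isUnit_fst, hfst]
    exact IsLocalization.map_units K y
  let τ : K →ₐ[k] DualNumber K := IsLocalization.liftAlgHom (M := nonZeroDivisors P) hg
  have hτ : ∀ p, τ (algebraMap P K p) = g p := fun p => IsLocalization.lift_eq _ p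
  have hτfst : ∀ x, (τ x).fst = x := by
    intro x
    have : (TrivSqZeroExt.fstHom k K K).comp τ = AlgHom.id k K := by
      apply IsLocalization.algHom_ext (nonZeroDivisors P)
      refine MvPolynomial.algHom_ext fun j => ?_
      change (τ (algebraMap P K (MvPolynomial.X j))).fst = algebraMap P K (MvPolynomial.X j)
      rw [hτ, hfst]
    exact DFunLike.congr_fun this x
  refine ⟨Derivation.mk' ((TrivSqZeroExt.sndHom K K).restrictScalars k ∘ₗ τ.toLinearMap) ?_, ?_⟩
  · intro a b
    simp [hτfst, mul_comm]
  · intro j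
    change (τ (algebraMap P K (MvPolynomial.X j))).snd = _
    rw [hτ]
    simp [hgX]

namespace MonoidAlgebra

/-- A subspace of a group algebra which is stable under the Frobenius endomorphism of the
coefficients is spanned by its Frobenius-invariant elements. -/
theorem mem_span_map_frobenius_eq {K G : Type*} [Field K] (p : ℕ) [ExpChar K p]
    (V : Submodule K (MonoidAlgebra K G))
    (hV : ∀ x ∈ V, map (frobenius K p : K →+ K) x ∈ V) (x : MonoidAlgebra K G) (hx : x ∈ V) :
    x ∈ Submodule.span K {y | y ∈ V ∧ map (frobenius K p : K →+ K) y = y} := by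
  induction hn : x.coeff.support.card using Nat.strong_induction_on generalizing x with
  | _ n ih =>
  subst hn
  have ih' : ∀ y ∈ V, y.coeff.support ⊂ x.coeff.support →
      y ∈ Submodule.span K {y | y ∈ V ∧ map (frobenius K p : K →+ K) y = y} :=
    fun y hy hyx => ih _ (Finset.card_lt_card hyx) y hy rfl
  have hss : ∀ {y : MonoidAlgebra K G} (g : G), x.coeff g ≠ 0 → y.coeff g = 0 →
      (∀ a, x.coeff a = 0 → y.coeff a = 0) → y.coeff.support ⊂ x.coeff.support := by
    intro y g hxg hyg h
    refine (Finset.ssubset_iff_of_subset ?_).2 ⟨g, by simpa using hxg, by simpa using hyg⟩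
    intro a
    simpa using mt (h a)
  by_cases hmin : ∃ y ∈ V, y ≠ 0 ∧ y.coeff.support ⊂ x.coeff.support
  · obtain ⟨y, hyV, hy0, hyx⟩ := hmin
    obtain ⟨g, hg⟩ : ∃ g, y.coeff g ≠ 0 := by
      by_contra! h
      exact hy0 (MonoidAlgebra.ext (Finsupp.ext h))
    have hsub : ∀ a, x.coeff a = 0 → y.coeff a = 0 := fun a => by
      simpa using mt (@hyx.1 a)
    have hxy : x - (x.coeff g / y.coeff g) • y ∈ V := V.sub_mem hx (V.smul_mem _ hyV)
    have h1 := ih' _ hxy (hss g (fun h => hg (hsub g h)) (by simp [hg])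
      fun a ha => by simp [ha, hsub a ha])
    have h2 := Submodule.smul_mem _ (x.coeff g / y.coeff g) (ih' y hyV hyx)
    simpa using Submodule.add_mem _ h1 h2
  · push Not at hmin
    by_cases hx0 : x = 0
    · rw [hx0]; exact Submodule.zero_mem _
    obtain ⟨g, hg⟩ : ∃ g, x.coeff g ≠ 0 := by
      by_contra! h
      exact hx0 (MonoidAlgebra.ext (Finsupp.ext h))
    set y := (x.coeff g)⁻¹ • x with hy
    have hyV : y ∈ V := V.smul_mem _ hx
    have hfix : map (frobenius K p : K →+ K) y - y = 0 := by
      by_contra h0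
      refine hmin _ (V.sub_mem (hV y hyV) hyV) h0 (hss g hg ?_ fun a ha => ?_)
      · simp [hy, hg, frobenius_def]
      · simp [hy, ha]
    have hxy : x = x.coeff g • y := by simp [hy, smul_smul, hg]
    rw [hxy]
    exact Submodule.smul_mem _ _ (Submodule.subset_span ⟨hyV, sub_eq_zero.1 hfix⟩)

end MonoidAlgebra

theorem Ring.mem_jacobson_of_forall_isNilpotent {A : Type*} [Ring A] {x : A}
    (h : ∀ a, IsNilpotent (a * x)) : x ∈ Ring.jacobson A := by
  rw [← Ideal.jacobson_bot, Ideal.mem_jacobson_iff]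
  intro y
  obtain ⟨w, hw⟩ := (h y).isUnit_add_one
  refine ⟨↑w⁻¹, ?_⟩
  have : (↑w⁻¹ : A) * (y * x + 1) = 1 := by rw [← hw]; simp
  rw [mul_add, mul_one, ← mul_assoc] at this
  simp [this]

theorem Ring.isNilpotent_of_mem_jacobson {A : Type*} [Ring A] [IsSemiprimaryRing A] {x : A}
    (h : x ∈ Ring.jacobson A) : IsNilpotent x := by
  obtain ⟨n, hn⟩ := IsSemiprimaryRing.isNilpotent (R := A)
  refine ⟨n, ?_⟩
  have := Ideal.pow_mem_pow h n
  rwa [hn] at this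

/-- Semisimple rings are von Neumann regular. -/
theorem IsSemisimpleRing.exists_mul_mul_eq {B : Type*} [Ring B] [IsSemisimpleRing B] (b : B) :
    ∃ h, b * h * b = b := by
  obtain ⟨C, hC⟩ := exists_isCompl (Ideal.span {b})
  have h1 : (1 : B) ∈ Ideal.span {b} ⊔ C := by simp [hC.sup_eq_top]
  obtain ⟨y, hy, c, hc, h⟩ := Submodule.mem_sup.1 h1
  obtain ⟨a, rfl⟩ := Ideal.mem_span_singleton'.1 hy
  refine ⟨a, ?_⟩
  have hbc : b * c = b - b * a * b := by
    rw [eq_sub_iff_add_eq', mul_assoc, ← mul_add, h, mul_one]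
  have h0 : b * c ∈ Ideal.span {b} ⊓ C := by
    refine ⟨?_, C.mul_mem_left _ hc⟩
    rw [hbc]
    have hb := Ideal.mem_span_singleton_self b
    exact Submodule.sub_mem _ hb (Ideal.mul_mem_left _ _ hb)
  rw [hC.inf_eq_bot, Submodule.mem_bot, hbc, sub_eq_zero] at h0
  exact h0.symm

theorem IsSemiprimaryRing.exists_sub_mul_mul_mem_jacobson {A : Type*} [Ring A]
    [IsSemiprimaryRing A] (a : A) : ∃ h, a - a * h * a ∈ Ring.jacobson A := by
  obtain ⟨h, hh⟩ := IsSemisimpleRing.exists_mul_mul_eq (Ideal.Quotient.mk (Ring.jacobson A) a)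
  obtain ⟨h, rfl⟩ := Ideal.Quotient.mk_surjective h
  refine ⟨h, ?_⟩
  rw [← Ideal.Quotient.mk_eq_mk_iff_sub_mem]
  simpa using hh.symm

theorem Ideal.restrictScalars_pow_le {K A : Type*} [CommSemiring K] [Semiring A] [Algebra K A]
    (I : Ideal A) (n : ℕ) :
    I.restrictScalars K ^ n ≤ Submodule.restrictScalars K (I ^ n) := by
  induction n with
  | zero =>
    intro x _
    rw [Submodule.restrictScalars_mem, Submodule.pow_zero, Ideal.one_eq_top]
    trivial
  | succ n ih =>
    rw [pow_succ, Submodule.mul_le]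
    exact fun a ha b hb => Ideal.mul_mem_mul (ih ha) hb

/-- If `u` has the inner inverse `h` modulo an ideal `I` stable under a derivation `D`, then `D u`
maps the kernel of `u` into the image of `u` modulo `I`. -/
theorem Ideal.one_sub_mul_deriv_mul_one_sub_mem {A : Type*} [Ring A] (I : Ideal A) [I.IsTwoSided]
    (D : A →+ A) (hD : ∀ a b, D (a * b) = D a * b + a * D b) (hDI : ∀ a ∈ I, D a ∈ I) {u h : A}
    (huh : u - u * h * u ∈ I) : (1 - u * h) * D u * (1 - h * u) ∈ I := by
  have hDu := hDI _ huh
  have key : (1 - u * h) * D u * (1 - h * u) =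
      (1 - u * h) * D (u - u * h * u) * (1 - h * u) + (u - u * h * u) * (D h * (u * (1 - h * u)))
      + (u - u * h * u) * (h * D u * (1 - h * u))
      + ((1 - u * h) * D u * h) * (u - u * h * u) := by
    rw [map_sub, hD, hD]
    noncomm_ring
  rw [key]
  refine I.add_mem (I.add_mem (I.add_mem ?_ ?_) ?_) ?_
  · exact I.mul_mem_right _ (I.mul_mem_left _ hDu)
  · exact I.mul_mem_right _ huh
  · exact I.mul_mem_right _ huh
  · exact I.mul_mem_left _ huh

/-- If `u` squares to zero and has the inner inverse `h` modulo `P`, and the elements of `l` commute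
with `u` and map its kernel into its image modulo `P`, then `l.prod * u` lies in a power of `P` up
to an element of `u * A * u`. -/
theorem Submodule.exists_prod_mul_add_mem_pow {K A : Type*} [CommRing K] [Ring A] [Algebra K A]
    (P : Submodule K A) {u h : A} (hu : u * u = 0) (huh : u - u * h * u ∈ P) (l : List A)
    (hl : ∀ x ∈ l, Commute x u ∧ (1 - u * h) * x * (1 - h * u) ∈ P) :
    ∃ w, l.prod * u + u * w * u ∈ P ^ (l.length + 1) := by
  induction l with
  | nil => exact ⟨-h, by simpa [sub_eq_add_neg] using huh⟩
  | cons x l ih =>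
    obtain ⟨w, hw⟩ := ih fun y hy => hl y (List.mem_cons_of_mem _ hy)
    have hq : l.prod * u = u * l.prod :=
      Commute.list_prod_left l u fun y hy => (hl y (List.mem_cons_of_mem _ hy)).1
    obtain ⟨hxu, hx⟩ := hl x List.mem_cons_self
    set q := l.prod
    refine ⟨x * w - h * x * q - h * x * u * w, ?_⟩
    have h1 : u * (q * u + u * w * u) = 0 := by
      rw [hq, mul_add, ← mul_assoc, hu, mul_assoc u w u, ← mul_assoc, hu]; simp
    have key : (x :: l).prod * u + u * (x * w - h * x * q - h * x * u * w) * u =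
        (1 - u * h) * x * (1 - h * u) * (q * u + u * w * u) := by
      calc (x :: l).prod * u + u * (x * w - h * x * q - h * x * u * w) * u
          = (1 - u * h) * x * (1 - h * u) * (q * u + u * w * u) + (u * x - x * u) * w * u
            + (1 - u * h) * x * h * (u * (q * u + u * w * u)) := by
            rw [List.prod_cons]; noncomm_ring
        _ = _ := by rw [h1, hxu.eq]; simp
    rw [key, List.length_cons, pow_succ' P (l.length + 1)]
    exact Submodule.mul_mem_mul hx hw

namespace MonoidAlgebra

instance {K G : Type*} [Field K] [Group G] [Finite G] : IsArtinianRing (MonoidAlgebra K G) :=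
  IsArtinianRing.of_finite K _

/-- The Jacobson radical of a group algebra is stable under the Frobenius endomorphism of the
coefficients. -/
theorem map_frobenius_mem_jacobson {K G : Type*} [Field K] [Group G] [Finite G] (p : ℕ)
    [ExpChar K p] {x : MonoidAlgebra K G} (hx : x ∈ Ring.jacobson (MonoidAlgebra K G)) :
    map (frobenius K p : K →+ K) x ∈ Ring.jacobson (MonoidAlgebra K G) := by
  let J := Ring.jacobson (MonoidAlgebra K G)
  let φ := mapRingHom G (frobenius K p)
  let S := Submodule.span K (φ '' (J.restrictScalars K : Set (MonoidAlgebra K G)))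
  obtain ⟨n, hn⟩ : IsNilpotent J := IsSemiprimaryRing.isNilpotent
  have hS : S ^ n = ⊥ := by
    rw [Submodule.span_pow, Submodule.span_eq_bot, ← Set.image_pow]
    rintro _ ⟨y, hy, rfl⟩
    have := J.restrictScalars_pow_le (K := K) n (Submodule.pow_subset_pow _ hy)
    rw [hn] at this
    rw [show y = 0 from this, map_zero]
  refine Ring.mem_jacobson_of_forall_isNilpotent fun a => ⟨n, ?_⟩
  have ha : a * φ x ∈ S := by
    induction a using MonoidAlgebra.induction_linear with
    | zero => simp
    | add a b ha hb => rw [add_mul]; exact S.add_mem ha hb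
    | single g c =>
      have : single g c * φ x = c • φ (single g 1 * x) := by
        rw [map_mul, ← smul_mul_assoc]
        simp [φ]
      rw [this]
      exact S.smul_mem _ (Submodule.subset_span ⟨_, J.mul_mem_left _ hx, rfl⟩)
  have := Submodule.pow_mem_pow S ha n
  rwa [hS] at this

/-- In characteristic `2` the Jacobson radical of a group algebra is defined over any subfield. -/
theorem mem_span_map_jacobson {k K G : Type*} [Field k] [Field K] [Algebra k K] [CharP K 2]
    [Group G] [Finite G] {x : MonoidAlgebra K G} (hx : x ∈ Ring.jacobson (MonoidAlgebra K G)) :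
    x ∈ Submodule.span K (mapRingHom G (algebraMap k K) ''
      (Ring.jacobson (MonoidAlgebra k G) : Set (MonoidAlgebra k G)) ∩
        (Ring.jacobson (MonoidAlgebra K G) : Set (MonoidAlgebra K G))) := by
  have : ExpChar K 2 := ExpChar.prime Nat.prime_two
  refine Submodule.span_mono ?_ (mem_span_map_frobenius_eq 2
    ((Ring.jacobson (MonoidAlgebra K G)).restrictScalars K)
    (fun x hx => map_frobenius_mem_jacobson 2 hx) x hx)
  rintro y ⟨hyJ, hy⟩
  have hy' : y ∈ Set.range (map (M := G) (algebraMap k K : k →+ K)) := by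
    rw [range_map]
    intro g
    have h := congrArg (fun z : MonoidAlgebra K G => z.coeff g) hy
    simp only [coeff_map, Finsupp.mapRange_apply, AddMonoidHom.coe_coe, frobenius_def] at h
    have h' : y.coeff g * (y.coeff g - 1) = 0 := by linear_combination h
    rcases mul_eq_zero.1 h' with h0 | h1
    · exact ⟨0, by simp [h0]⟩
    · exact ⟨1, by simp [sub_eq_zero.1 h1]⟩
  obtain ⟨z, rfl⟩ := hy'
  refine ⟨⟨z, ?_, rfl⟩, hyJ⟩
  refine Ring.mem_jacobson_of_forall_isNilpotent fun a => ?_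
  have hinj : Function.Injective (mapRingHom G (algebraMap k K)) :=
    map_injective _ (algebraMap k K).injective
  rw [← IsNilpotent.map_iff hinj, map_mul]
  exact Ring.isNilpotent_of_mem_jacobson (Ideal.mul_mem_left _ _ hyJ)

/-- A derivation of the coefficients induces a derivation of the group algebra. -/
theorem map_derivation_mul {k K G : Type*} [CommRing k] [CommRing K] [Algebra k K] [Group G]
    (D : Derivation k K K) (x y : MonoidAlgebra K G) :
    map (D : K →+ K) (x * y) = map (D : K →+ K) x * y + x * map (D : K →+ K) y := by
  induction x using MonoidAlgebra.induction_linear with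
  | zero => simp
  | add a b ha hb => simp only [add_mul, MonoidAlgebra.map_add, ha, hb]; abel
  | single g c =>
    induction y using MonoidAlgebra.induction_linear with
    | zero => simp
    | add a b ha hb => simp only [mul_add, MonoidAlgebra.map_add, ha, hb]; abel
    | single h d =>
      simp [single_mul_single, ← single_add, mul_comm, add_comm]

/-- In characteristic `2` the Jacobson radical of a group algebra is stable under derivations of the
coefficients. -/
theorem map_derivation_mem_jacobson {k K G : Type*} [Field k] [Field K] [Algebra k K] [CharP K 2]
    [Group G] [Finite G] (D : Derivation k K K) {x : MonoidAlgebra K G}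
    (hx : x ∈ Ring.jacobson (MonoidAlgebra K G)) :
    map (D : K →+ K) x ∈ Ring.jacobson (MonoidAlgebra K G) := by
  let J := (Ring.jacobson (MonoidAlgebra K G)).restrictScalars K
  change map (D : K →+ K) x ∈ J
  have hx' := mem_span_map_jacobson (k := k) hx
  induction hx' using Submodule.span_induction with
  | mem y hy =>
    obtain ⟨⟨z, -, rfl⟩, -⟩ := hy
    have : map (D : K →+ K) (mapRingHom G (algebraMap k K) z) = 0 := by ext; simp
    rw [this]
    exact J.zero_mem
  | zero => rw [MonoidAlgebra.map_zero]; exact J.zero_mem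
  | add a b ha hb iha ihb =>
    rw [MonoidAlgebra.map_add]
    exact J.add_mem (iha (Submodule.span_le (p := J).2 Set.inter_subset_right ha))
      (ihb (Submodule.span_le (p := J).2 Set.inter_subset_right hb))
  | smul c a ha iha =>
    have haJ : a ∈ J := Submodule.span_le.2 Set.inter_subset_right ha
    have : map (D : K →+ K) (c • a) = D c • a + c • map (D : K →+ K) a := by
      ext
      simp [mul_comm, add_comm]
    rw [this]
    exact J.add_mem (J.smul_mem _ haJ) (J.smul_mem _ (iha haJ))

/-- If all products of `n` elements of the radical of `kG` vanish, then the same holds over every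
extension field. -/
theorem restrictScalars_jacobson_pow_eq_bot {k K G : Type*} [Field k] [Field K] [Algebra k K]
    [CharP K 2] [Group G] [Finite G] {n : ℕ}
    (h : ∀ x : Fin n → MonoidAlgebra k G,
      (∀ j, x j ∈ Ring.jacobson (MonoidAlgebra k G)) → (List.ofFn x).prod = 0) :
    (Ring.jacobson (MonoidAlgebra K G)).restrictScalars K ^ n = ⊥ := by
  rw [eq_bot_iff]
  have hle : (Ring.jacobson (MonoidAlgebra K G)).restrictScalars K ≤
      Submodule.span K (mapRingHom G (algebraMap k K) ''
        (Ring.jacobson (MonoidAlgebra k G) : Set (MonoidAlgebra k G))) :=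
    fun x hx => Submodule.span_mono Set.inter_subset_left (mem_span_map_jacobson hx)
  refine (pow_le_pow_left' hle n).trans ?_
  rw [Submodule.span_pow, Submodule.span_le, ← Set.image_pow]
  rintro _ ⟨y, hy, rfl⟩
  obtain ⟨f, rfl⟩ := Set.mem_pow.1 hy
  rw [h _ fun j => (f j).2, map_zero]
  exact Submodule.zero_mem _

theorem comapDomain_mapDomain_mul {K H G : Type*} [Semiring K] [Group H] [Group G] (f : H →* G)
    (hf : Function.Injective f) (a : MonoidAlgebra K H) (x : MonoidAlgebra K G) :
    comapDomain f hf (mapDomain f a * x) = a * comapDomain f hf x := by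
  induction a using MonoidAlgebra.induction_linear with
  | zero => simp
  | add a b ha hb => simp only [mapDomain_add, add_mul, comapDomain_add, ha, hb]
  | single h c =>
    induction x using MonoidAlgebra.induction_linear with
    | zero => simp
    | add a b ha hb => simp only [mul_add, comapDomain_add, ha, hb]
    | single g d =>
      rw [mapDomain_single, single_mul_single]
      by_cases hg : g ∈ Set.range f
      · obtain ⟨h', rfl⟩ := hg
        rw [← map_mul, comapDomain_single_map, comapDomain_single_map, single_mul_single]
      · rw [comapDomain_single_of_not_mem_range hg, mul_zero, comapDomain_single_of_not_mem_range]
        rintro ⟨h', hh⟩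
        exact hg ⟨h⁻¹ * h', by simp [hh]⟩

theorem comapDomain_mul_mapDomain {K H G : Type*} [Semiring K] [Group H] [Group G] (f : H →* G)
    (hf : Function.Injective f) (x : MonoidAlgebra K G) (a : MonoidAlgebra K H) :
    comapDomain f hf (x * mapDomain f a) = comapDomain f hf x * a := by
  induction a using MonoidAlgebra.induction_linear with
  | zero => simp
  | add a b ha hb => simp only [mapDomain_add, mul_add, comapDomain_add, ha, hb]
  | single h c =>
    induction x using MonoidAlgebra.induction_linear with
    | zero => simp
    | add a b ha hb => simp only [add_mul, comapDomain_add, ha, hb]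
    | single g d =>
      rw [mapDomain_single, single_mul_single]
      by_cases hg : g ∈ Set.range f
      · obtain ⟨h', rfl⟩ := hg
        rw [← map_mul, comapDomain_single_map, comapDomain_single_map, single_mul_single]
      · rw [comapDomain_single_of_not_mem_range hg, zero_mul, comapDomain_single_of_not_mem_range]
        rintro ⟨h', hh⟩
        exact hg ⟨h' * h⁻¹, by simp [hh]⟩

/-- The element `eᵢ + 1` of the group algebra of `(ℤ/2ℤ)^ι`, where `eᵢ` is the `i`-th standard
generator. -/
noncomputable def genAddOne (K : Type*) [Semiring K] {ι : Type*} [DecidableEq ι] (i : ι) :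
    MonoidAlgebra K (Multiplicative (ι → ZMod 2)) :=
  single (Multiplicative.ofAdd (Pi.single i 1)) 1 + 1

theorem map_derivation_mapDomain_smul_genAddOne {k K G ι : Type*} [CommRing k] [CommRing K]
    [Algebra k K] [Group G] [DecidableEq ι] (D : Derivation k K K)
    (f : Multiplicative (ι → ZMod 2) →* G) (c : K) (i : ι) :
    map (D : K →+ K) (mapDomain f (c • genAddOne K i)) = D c • mapDomain f (genAddOne K i) := by
  simp [genAddOne, one_def, smul_add, mapDomain_add, MonoidAlgebra.map_add]

theorem genAddOne_mul_self {K : Type*} [CommRing K] [CharP K 2] {ι : Type*} [DecidableEq ι]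
    (i : ι) : genAddOne K i * genAddOne K i = 0 := by
  have h1 : (single (Multiplicative.ofAdd (Pi.single i 1)) 1 :
      MonoidAlgebra K (Multiplicative (ι → ZMod 2))) *
      single (Multiplicative.ofAdd (Pi.single i 1)) 1 = 1 := by
    rw [single_mul_single, ← ofAdd_add, ← Pi.single_add, CharTwo.add_self_eq_zero]
    simp [one_def]
  have h2 : (2 : MonoidAlgebra K (Multiplicative (ι → ZMod 2))) = 0 := by
    rw [ofNat_def, show (OfNat.ofNat 2 : K) = 0 from CharTwo.two_eq_zero, single_zero]
  unfold genAddOne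
  linear_combination h1 + (single (Multiplicative.ofAdd (Pi.single i 1)) 1 + 1) * h2

theorem prod_genAddOne_ne_zero (K : Type*) [CommRing K] [Nontrivial K] (ι : Type*) [Fintype ι]
    [DecidableEq ι] : ∏ i : ι, genAddOne K i ≠ 0 := by
  intro h
  have h1 : (∏ i : ι, genAddOne K i).coeff 1 = 1 := by
    unfold genAddOne
    rw [Finset.prod_add_one, coeff_sum, Finsupp.finsetSum_apply, Finset.sum_eq_single ∅]
    · simp
    · intro t _ ht
      obtain ⟨i, hi⟩ := Finset.nonempty_of_ne_empty ht
      have : ∏ j ∈ t, (single (Multiplicative.ofAdd (Pi.single j 1)) 1 :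
          MonoidAlgebra K (Multiplicative (ι → ZMod 2))) =
          single (Multiplicative.ofAdd (∑ j ∈ t, Pi.single j 1)) 1 := by
        simp only [← of_apply, ofAdd_sum, map_prod]
      rw [this, coeff_single, Finsupp.single_eq_of_ne]
      intro h0
      have := congrFun (congrArg Multiplicative.toAdd h0) i
      simp [Finset.sum_apply, Pi.single_apply, hi] at this
    · simp
  simp [h] at h1

end MonoidAlgebra

/-- **Rouquier, Theorem 7.17 (Benson's conjecture in characteristic 2).**
Let `k` be a field of characteristic `2` and `G` a finite group. Then the Loewy length of
the group algebra `kG` is strictly greater than the `2`-rank of `G` : if `G` contains a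
subgroup isomorphic to `(ℤ/2ℤ)^r`, then `J(kG)^r ≠ 0`, i.e. there are `r` elements of the
Jacobson radical of `kG` whose product is nonzero. -/
theorem loewyLength_groupAlgebra_gt_two_rank
    (k : Type u) [Field k] [CharP k 2] (G : Type v) [Group G] [Finite G] (r : ℕ)
    (H : Subgroup G) (hH : Nonempty (H ≃* Multiplicative (Fin r → ZMod 2))) :
    ∃ x : Fin r → MonoidAlgebra k G,
      (∀ j, x j ∈ Ideal.jacobson (⊥ : Ideal (MonoidAlgebra k G))) ∧
      (List.ofFn x).prod ≠ 0 := by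
  obtain _ | d := r
  · exact ⟨fun _ => 0, fun j => j.elim0, by simp⟩
  by_contra! hcon
  rw [Ideal.jacobson_bot] at hcon
  obtain ⟨e⟩ := hH
  let P := MvPolynomial (Fin d) k
  let K := FractionRing P
  have hK : CharP K 2 := charP_of_injective_algebraMap (algebraMap k K).injective 2
  let C := MonoidAlgebra K (Multiplicative (Fin (d + 1) → ZMod 2))
  have hC : CharP C 2 :=
    charP_of_injective_algebraMap (R := K) (A := C) (algebraMap K C).injective 2
  let f : Multiplicative (Fin (d + 1) → ZMod 2) →* G := H.subtype.comp e.symm.toMonoidHom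
  have hf : Function.Injective f := H.subtype_injective.comp e.symm.injective
  let ψ : C →+* MonoidAlgebra K G := MonoidAlgebra.mapDomainRingHom K f
  let X : Fin (d + 1) → C := MonoidAlgebra.genAddOne K
  let s : Fin d → K := fun i => algebraMap P K (MvPolynomial.X i)
  let U : C := X 0 + ∑ i, s i • X (Fin.succ i)
  have hX : ∀ i, X i * X i = 0 := MonoidAlgebra.genAddOne_mul_self
  have hU : U * U = 0 := by
    rw [← sq, CharTwo.add_sq, CharTwo.sum_sq]
    simp [sq, hX]
  obtain ⟨h, hh⟩ := IsSemiprimaryRing.exists_sub_mul_mul_mem_jacobson (ψ U)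
  have hmem : ∀ i : Fin d, (1 - ψ U * h) * ψ (X i.succ) * (1 - h * ψ U) ∈
      Ring.jacobson (MonoidAlgebra K G) := by
    intro i
    obtain ⟨D, hD⟩ := exists_derivation_fractionRing k i
    let δ : MonoidAlgebra K G →+ MonoidAlgebra K G :=
      { toFun := MonoidAlgebra.map (D : K →+ K)
        map_zero' := MonoidAlgebra.map_zero _
        map_add' := MonoidAlgebra.map_add _ }
    have hδX : ∀ (c : K) j, δ (ψ (c • X j)) = D c • ψ (X j) :=
      MonoidAlgebra.map_derivation_mapDomain_smul_genAddOne D f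
    have hδU : δ (ψ U) = ψ (X i.succ) := by
      have h0 : δ (ψ (X 0)) = 0 := by simpa using hδX 1 0
      have hs : ∀ j, D (s j) = if j = i then 1 else 0 := hD
      simp only [U, map_add, map_sum, h0, hδX, hs, zero_add]
      simp
    rw [← hδU]
    exact Ideal.one_sub_mul_deriv_mul_one_sub_mem _ δ (MonoidAlgebra.map_derivation_mul D)
      (fun a ha => MonoidAlgebra.map_derivation_mem_jacobson D ha) hh
  obtain ⟨w, hw⟩ := Submodule.exists_prod_mul_add_mem_pow
    ((Ring.jacobson (MonoidAlgebra K G)).restrictScalars K) (u := ψ U) (h := h)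
    (by rw [← map_mul, hU, map_zero]) hh (List.ofFn fun i : Fin d => ψ (X i.succ)) (by
      intro x hx
      obtain ⟨i, rfl⟩ := (List.mem_ofFn' _ _).1 hx
      exact ⟨(Commute.all (X i.succ) U).map ψ, hmem i⟩)
  rw [List.length_ofFn, MonoidAlgebra.restrictScalars_jacobson_pow_eq_bot hcon,
    Submodule.mem_bot] at hw
  have hprod : (List.ofFn fun i : Fin d => ψ (X i.succ)).prod = ψ (∏ i : Fin d, X i.succ) := by
    rw [← List.prod_ofFn, map_list_prod, List.map_ofFn]
    rfl
  have hUprod : (∏ i : Fin d, X i.succ) * U = ∏ i, X i := by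
    have h0 : ∀ i : Fin d, (∏ i : Fin d, X i.succ) * X i.succ = 0 := fun i => by
      rw [← Finset.mul_prod_erase _ _ (Finset.mem_univ i), mul_right_comm, hX, zero_mul]
    rw [Fin.prod_univ_succ, mul_add, Finset.mul_sum]
    simp [h0, mul_comm]
  rw [hprod, ← map_mul, hUprod] at hw
  have hres := congrArg (MonoidAlgebra.comapDomain f hf) hw
  have hres' : (∏ i, X i) + U * MonoidAlgebra.comapDomain f hf w * U = 0 := by
    have h1 : MonoidAlgebra.comapDomain f hf (ψ (∏ i, X i)) = ∏ i, X i := by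
      have := MonoidAlgebra.comapDomain_mapDomain_mul f hf (∏ i, X i) 1
      rw [mul_one] at this
      refine this.trans ?_
      rw [MonoidAlgebra.one_def, ← map_one f, MonoidAlgebra.comapDomain_single_map,
        ← MonoidAlgebra.one_def, mul_one]
    have h2 : MonoidAlgebra.comapDomain f hf (ψ U * w * ψ U) =
        U * MonoidAlgebra.comapDomain f hf w * U :=
      (MonoidAlgebra.comapDomain_mul_mapDomain f hf _ U).trans
        (congrArg (· * U) (MonoidAlgebra.comapDomain_mapDomain_mul f hf U w))
    rw [← h1, ← h2, ← MonoidAlgebra.comapDomain_add, hw, MonoidAlgebra.comapDomain_zero]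
  rw [mul_right_comm, hU, zero_mul, add_zero] at hres'
  exact MonoidAlgebra.prod_genAddOne_ne_zero K (Fin (d + 1)) hres'
end

section
/- Let k be a commutative ring and T a strongly finitely generated k-linear triangulated category. A cohomological functor H: T^op → k-Mod is locally finitely presented if and only if H is a direct summand of a representable functor h_C for some C ∈ T. -/
open CategoryTheory CategoryTheory.Limits CategoryTheory.Pretriangulated

universe w v u

namespace Rouquier

variable {C : Type u} [Category.{v} C] [HasZeroObject C] [Preadditive C]
  [HasShift C ℤ] [∀ n : ℤ, (shiftFunctor C n).Additive] [Pretriangulated C]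

/-- `Z` is a direct sum of `X` and `Y`, witnessed by the given injections and projections. -/
def IsDirSum {X Y Z : C} (i₁ : X ⟶ Z) (i₂ : Y ⟶ Z) (p₁ : Z ⟶ X) (p₂ : Z ⟶ Y) : Prop :=
  i₁ ≫ p₁ = 𝟙 X ∧ i₂ ≫ p₂ = 𝟙 Y ∧ p₁ ≫ i₁ + p₂ ≫ i₂ = 𝟙 Z

/-- `⟨I⟩`, computed inside the full (triangulated) subcategory of objects satisfying `S` :
the closure of `I` under finite direct sums, direct summands and shifts. -/
inductive addHullIn (S : C → Prop) (I : C → Prop) : C → Prop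
  | of {X : C} : I X → S X → addHullIn S I X
  | shift {X : C} (n : ℤ) : addHullIn S I X → S (X⟦n⟧) → addHullIn S I (X⟦n⟧)
  | sum {X Y Z : C} (i₁ : X ⟶ Z) (i₂ : Y ⟶ Z) (p₁ : Z ⟶ X) (p₂ : Z ⟶ Y) :
      IsDirSum i₁ i₂ p₁ p₂ → addHullIn S I X → addHullIn S I Y → S Z → addHullIn S I Z
  | smd {X Y : C} (i : Y ⟶ X) (p : X ⟶ Y) :
      i ≫ p = 𝟙 Y → addHullIn S I X → S Y → addHullIn S I Y

/-- `I₁ ∗ I₂` computed inside `S` : objects `X` of `S` fitting in a distinguished triangle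
`X₁ ⟶ X ⟶ X₂ ⟶ X₁⟦1⟧` with `X₁ ∈ I₁` and `X₂ ∈ I₂`. -/
def starIn (S I₁ I₂ : C → Prop) : C → Prop := fun X =>
  ∃ (X₁ X₂ : C) (f : X₁ ⟶ X) (g : X ⟶ X₂) (h : X₂ ⟶ X₁⟦(1 : ℤ)⟧),
    S X ∧ I₁ X₁ ∧ I₂ X₂ ∧ Triangle.mk f g h ∈ distTriang C

/-- `⟨I⟩_d` computed inside `S`, defined by `⟨I⟩₀ = {0}` and
`⟨I⟩_d = ⟨I⟩_{d-1} ◇ ⟨I⟩ = ⟨⟨I⟩_{d-1} ∗ ⟨I⟩⟩`. -/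
def hullStepIn (S I : C → Prop) : ℕ → C → Prop
  | 0 => fun X => IsZero X ∧ S X
  | d + 1 => addHullIn S (starIn S (hullStepIn S I d) (addHullIn S I))

/-- `⟨I⟩` : the closure of `I` under finite direct sums, direct summands and shifts. -/
abbrev addHull (I : C → Prop) : C → Prop := addHullIn (fun _ => True) I

/-- `I₁ ∗ I₂`. -/
abbrev star (I₁ I₂ : C → Prop) : C → Prop := starIn (fun _ => True) I₁ I₂

/-- `⟨I⟩_d` for `d : ℕ`. -/
abbrev hullStep (I : C → Prop) : ℕ → C → Prop := hullStepIn (fun _ => True) I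

/-- `⟨I⟩_∞ = ⋃_d ⟨I⟩_d`. -/
def hullOmega (I : C → Prop) : C → Prop := fun X => ∃ d : ℕ, hullStep I d X

/-- `⟨I⟩_d` for `d ∈ ℕ ∪ {∞}`. -/
def hullE (I : C → Prop) : ℕ∞ → C → Prop := fun e =>
  e.recTopCoe (hullOmega I) (fun d => hullStep I d)

variable (C)

/-- The dimension of `C` is at most `d` : there is `M` with `C = ⟨M⟩_{d+1}`. -/
def DimLE (d : ℕ) : Prop := ∃ M : C, ∀ X : C, hullStep (fun Y => Y = M) (d + 1) X

/-- The dimension of the triangulated category `C`, an element of `ℕ ∪ {∞}` :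
the least `d` such that `C = ⟨M⟩_{d+1}` for some object `M`. -/
noncomputable def trDim : ℕ∞ := ⨅ (d : ℕ) (_ : DimLE C d), (d : ℕ∞)

variable {C}

/-- The dimension of the full triangulated subcategory of objects satisfying `S`
is at most `d` : there is `M` in `S` with `S = ⟨M⟩_{d+1}`, the hull being computed in `S`. -/
def SubDimLE (S : C → Prop) (d : ℕ) : Prop :=
  ∃ M : C, S M ∧ ∀ X : C, S X ↔ hullStepIn S (fun Y => Y = M) (d + 1) X

/-- The dimension of the full triangulated subcategory of objects satisfying `S`. -/
noncomputable def subDim (S : C → Prop) : ℕ∞ := ⨅ (d : ℕ) (_ : SubDimLE S d), (d : ℕ∞)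

end Rouquier
namespace Rouquier

variable {k : Type w} [CommRing k]
variable {C : Type u} [Category.{v} C] [HasZeroObject C] [Preadditive C] [Linear k C]
  [HasShift C ℤ] [∀ n : ℤ, (shiftFunctor C n).Additive] [Pretriangulated C]

/-- A functor `H : Cᵒᵖ ⥤ k-Mod` is cohomological if it sends distinguished triangles
`X ⟶ Y ⟶ Z ⟶ X⟦1⟧` to exact sequences `H(Z) ⟶ H(Y) ⟶ H(X)`. -/
def Cohomological (H : Cᵒᵖ ⥤ ModuleCat.{v} k) : Prop :=
  ∀ T : Triangle C, T ∈ (distTriang C) →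
    Function.Exact (H.map T.mor₂.op) (H.map T.mor₁.op)

/-- `H` is locally finitely generated : for every `X` there are `D : C` and
`α : h_D ⟶ H` with `α(X⟦i⟧)` surjective for all `i : ℤ`. -/
def LocFinGen (H : Cᵒᵖ ⥤ ModuleCat.{v} k) : Prop :=
  ∀ X : C, ∃ (D : C) (α : (linearYoneda k C).obj D ⟶ H),
    ∀ i : ℤ, Function.Surjective (α.app (Opposite.op (X⟦i⟧)))

/-- `H` is locally finitely presented : it is locally finitely generated, and the kernel
of any natural transformation `h_E ⟶ H` is locally finitely generated. -/
def LocFinPres (H : Cᵒᵖ ⥤ ModuleCat.{v} k) : Prop :=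
  LocFinGen H ∧
  ∀ (E : C) (β : (linearYoneda k C).obj E ⟶ H) (X : C),
    ∃ (F : C) (f : F ⟶ E), (linearYoneda k C).map f ≫ β = 0 ∧
      ∀ (i : ℤ) (y : X⟦i⟧ ⟶ E), β.app (Opposite.op (X⟦i⟧)) y = 0 →
        ∃ g : X⟦i⟧ ⟶ F, g ≫ f = y

end Rouquier

namespace Rouquier

section Approximation

variable {k : Type w} [CommRing k]
variable {C : Type u} [Category.{v} C]

/-- The restriction of `a ∈ H(Y)` along `f : X ⟶ Y`. -/
def pull (H : Cᵒᵖ ⥤ ModuleCat.{v} k) {X Y : C} (f : X ⟶ Y) (a : H.obj (Opposite.op Y)) :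
    H.obj (Opposite.op X) :=
  (H.map f.op).hom a

section Basic

variable (H : Cᵒᵖ ⥤ ModuleCat.{v} k)

lemma pull_id {X : C} (a : H.obj (Opposite.op X)) : pull H (𝟙 X) a = a := by
  simp [pull]

lemma pull_comp {X Y Z : C} (f : X ⟶ Y) (g : Y ⟶ Z) (a : H.obj (Opposite.op Z)) :
    pull H (f ≫ g) a = pull H f (pull H g a) := by
  simp [pull]

lemma pull_zero {X Y : C} (f : X ⟶ Y) : pull H f 0 = 0 :=
  map_zero (H.map f.op).hom

lemma pull_add {X Y : C} (f : X ⟶ Y) (a b : H.obj (Opposite.op Y)) :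
    pull H f (a + b) = pull H f a + pull H f b :=
  map_add (H.map f.op).hom a b

lemma pull_sub {X Y : C} (f : X ⟶ Y) (a b : H.obj (Opposite.op Y)) :
    pull H f (a - b) = pull H f a - pull H f b :=
  map_sub (H.map f.op).hom a b

lemma app_eq_pull [Preadditive C] [Linear k C] {D X : C} (α : (linearYoneda k C).obj D ⟶ H)
    (f : X ⟶ D) :
    (α.app (Opposite.op X)).hom f = pull H f ((α.app (Opposite.op D)).hom (𝟙 D)) := by
  have h := ConcreteCategory.congr_hom (α.naturality f.op) (𝟙 D)
  change (α.app (Opposite.op X)).hom (f ≫ 𝟙 D) = _ at h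
  rw [Category.comp_id] at h
  exact h

variable [Preadditive C] [H.Additive]

lemma add_pull {X Y : C} (f g : X ⟶ Y) (a : H.obj (Opposite.op Y)) :
    pull H (f + g) a = pull H f a + pull H g a := by
  simp [pull, op_add, H.map_add]

lemma sub_pull {X Y : C} (f g : X ⟶ Y) (a : H.obj (Opposite.op Y)) :
    pull H (f - g) a = pull H f a - pull H g a := by
  rw [eq_sub_iff_add_eq, ← add_pull, sub_add_cancel]

lemma zero_pull {X Y : C} (a : H.obj (Opposite.op Y)) :
    pull H (0 : X ⟶ Y) a = 0 := by
  rw [← sub_self (0 : X ⟶ Y), sub_pull, sub_self]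

variable [Linear k C]

/-- The natural transformation `h_D ⟶ H` attached to an element of `H(D)`. -/
def ofElement (hlin : ∀ (X Y : C) (c : k) (f : X ⟶ Y), H.map (c • f).op = c • H.map f.op)
    {D : C} (a : H.obj (Opposite.op D)) : (linearYoneda k C).obj D ⟶ H where
  app X := ModuleCat.ofHom (X := (X.unop ⟶ D)) (Y := H.obj X)
    { toFun f := pull H f a
      map_add' f g := add_pull H f g a
      map_smul' c f := by
        change (H.map (c • f).op).hom a = c • (H.map f.op).hom a
        rw [hlin]; rfl }
  naturality X Y f := by
    ext g
    exact pull_comp H f.unop g a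

end Basic

/-- `F` and `a` approximate `H` on `X` with delay `n`: for `i ≥ n` every element of `H(X)` is
a restriction of `a i`, and a map `X ⟶ F i` killing `a i` vanishes in `F (i + n)`. -/
def Approximates [Preadditive C] (H : Cᵒᵖ ⥤ ModuleCat.{v} k) (F : ℕ ⥤ C)
    (a : ∀ i, H.obj (Opposite.op (F.obj i))) (n : ℕ) (X : C) : Prop :=
  (∀ i, n ≤ i → ∀ x : H.obj (Opposite.op X), ∃ f : X ⟶ F.obj i, pull H f (a i) = x) ∧
  ∀ (i j : ℕ) (e : i ⟶ j), i + n ≤ j → ∀ f : X ⟶ F.obj i, pull H f (a i) = 0 →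
    f ≫ F.map e = 0

section Closure

variable [Preadditive C] {H : Cᵒᵖ ⥤ ModuleCat.{v} k} [H.Additive] {F : ℕ ⥤ C}
  {a : ∀ i, H.obj (Opposite.op (F.obj i))}

omit [H.Additive] in
lemma Approximates.mono {n m : ℕ} {X : C} (h : Approximates H F a n X) (hnm : n ≤ m) :
    Approximates H F a m X :=
  ⟨fun i hi => h.1 i (hnm.trans hi), fun i j e hij => h.2 i j e (by omega)⟩

omit [H.Additive] in
lemma Approximates.retract {n : ℕ} {X Y : C} (h : Approximates H F a n X) (i : Y ⟶ X)
    (p : X ⟶ Y) (hip : i ≫ p = 𝟙 Y) : Approximates H F a n Y := by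
  constructor
  · intro m hm x
    obtain ⟨f, hf⟩ := h.1 m hm (pull H p x)
    exact ⟨i ≫ f, by rw [pull_comp, hf, ← pull_comp, hip, pull_id]⟩
  · intro m l e hml f hf
    have := h.2 m l e hml (p ≫ f) (by rw [pull_comp, hf, pull_zero])
    rw [← Category.id_comp f, ← hip, Category.assoc, Category.assoc, ← Category.assoc p, this,
      comp_zero]

lemma Approximates.sum {n : ℕ} {X Y Z : C} (hX : Approximates H F a n X)
    (hY : Approximates H F a n Y) (i₁ : X ⟶ Z) (i₂ : Y ⟶ Z) (p₁ : Z ⟶ X) (p₂ : Z ⟶ Y)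
    (h : p₁ ≫ i₁ + p₂ ≫ i₂ = 𝟙 Z) : Approximates H F a n Z := by
  constructor
  · intro m hm x
    obtain ⟨f, hf⟩ := hX.1 m hm (pull H i₁ x)
    obtain ⟨g, hg⟩ := hY.1 m hm (pull H i₂ x)
    refine ⟨p₁ ≫ f + p₂ ≫ g, ?_⟩
    rw [add_pull, pull_comp, pull_comp, hf, hg, ← pull_comp, ← pull_comp, ← add_pull, h, pull_id]
  · intro m l e hml f hf
    have h₁ := hX.2 m l e hml (i₁ ≫ f) (by rw [pull_comp, hf, pull_zero])
    have h₂ := hY.2 m l e hml (i₂ ≫ f) (by rw [pull_comp, hf, pull_zero])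
    rw [Category.assoc] at h₁ h₂
    rw [← Category.id_comp f, ← h, Category.assoc, Preadditive.add_comp, Category.assoc,
      Category.assoc, h₁, h₂, comp_zero, comp_zero, add_zero]

lemma approximates_of_isZero {X : C} (hX : IsZero X) (n : ℕ) : Approximates H F a n X := by
  constructor
  · intro m _ x
    refine ⟨0, ?_⟩
    rw [zero_pull, ← pull_id H x, hX.eq_of_src (𝟙 X) 0, zero_pull]
  · intro m l e _ f _
    exact hX.eq_of_src _ _

end Closure

variable [HasZeroObject C] [Preadditive C] [HasShift C ℤ]
  [∀ n : ℤ, (shiftFunctor C n).Additive] [Pretriangulated C]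
  {H : Cᵒᵖ ⥤ ModuleCat.{v} k}

lemma Cohomological.exists_pull [Linear k C] (hH : Cohomological H) {T : Triangle C}
    (hT : T ∈ distTriang C)
    (x : H.obj (Opposite.op T.obj₂)) (hx : pull H T.mor₁ x = 0) :
    ∃ y : H.obj (Opposite.op T.obj₃), pull H T.mor₂ y = x :=
  (hH T hT x).1 hx

variable [H.Additive] {F : ℕ ⥤ C} {a : ∀ i, H.obj (Opposite.op (F.obj i))}

lemma Approximates.ext₂ [Linear k C] (hH : Cohomological H)
    (ha : ∀ (i j : ℕ) (e : i ⟶ j), pull H (F.map e) (a j) = a i)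
    {n : ℕ} {T : Triangle C} (hT : T ∈ distTriang C)
    (h₁ : Approximates H F a n T.obj₁) (h₁' : Approximates H F a n (T.obj₁⟦(1 : ℤ)⟧))
    (h₃ : Approximates H F a n T.obj₃) (h₃' : Approximates H F a n (T.obj₃⟦(-1 : ℤ)⟧)) :
    Approximates H F a (2 * n) T.obj₂ := by
  constructor
  · intro i hi x
    obtain ⟨f, hf⟩ := h₁.1 (i - n) (by omega) (pull H T.mor₁ x)
    let e : (i - n) ⟶ i := homOfLE (by omega)
    have hw : T.invRotate.mor₁ ≫ T.mor₁ = 0 :=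
      comp_distTriang_mor_zero₁₂ _ (inv_rot_of_distTriang T hT)
    have h0 : (T.invRotate.mor₁ ≫ f) ≫ F.map e = 0 :=
      h₃'.2 _ _ e (by omega) _ <|
        (pull_comp H _ _ _).trans <| (congrArg (pull H _) hf).trans <|
          (pull_comp H _ _ _).symm.trans <|
            (congrArg (fun q => pull H q x) hw).trans (zero_pull H x)
    obtain ⟨g, hg⟩ : ∃ g : T.obj₂ ⟶ F.obj i, f ≫ F.map e = T.mor₁ ≫ g :=
      Triangle.yoneda_exact₂ _ (inv_rot_of_distTriang T hT) (f ≫ F.map e)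
        ((Category.assoc _ _ _).symm.trans h0)
    obtain ⟨z, hz⟩ := hH.exists_pull hT (x - pull H g (a i)) (by
      rw [pull_sub, ← pull_comp, ← hg, pull_comp, ha, hf, sub_self])
    obtain ⟨l, hl⟩ := h₃.1 i (by omega) z
    refine ⟨T.mor₂ ≫ l + g, ?_⟩
    rw [add_pull, pull_comp, hl, hz, sub_add_cancel]
  · have hr := rot_of_distTriang T hT
    intro i j e hij f hf
    let e₁ : i ⟶ i + n := homOfLE (by omega)
    let e₂ : i + n ⟶ j := homOfLE (by omega)
    have h0 : (T.mor₁ ≫ f) ≫ F.map e₁ = 0 :=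
      h₁.2 _ _ e₁ le_rfl _ (by rw [pull_comp, hf, pull_zero])
    obtain ⟨g, hg⟩ := Triangle.yoneda_exact₂ _ hT (f ≫ F.map e₁)
      ((Category.assoc _ _ _).symm.trans h0)
    have hg0 : pull H T.mor₂ (pull H g (a (i + n))) = 0 := by
      rw [← pull_comp, ← hg, pull_comp, ha, hf]
    obtain ⟨z, hz⟩ : ∃ z : H.obj (Opposite.op (T.obj₁⟦(1 : ℤ)⟧)),
        pull H T.mor₃ z = pull H g (a (i + n)) :=
      hH.exists_pull hr (pull H g (a (i + n))) hg0
    obtain ⟨l, hl⟩ := h₁'.1 (i + n) (by omega) z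
    have hk := h₃.2 _ _ e₂ (by omega) (g - T.mor₃ ≫ l) (by
      rw [sub_pull, pull_comp, hl, hz, sub_self])
    have hw : T.mor₂ ≫ T.mor₃ = 0 := comp_distTriang_mor_zero₂₃ T hT
    have hg' : f ≫ F.map e₁ = T.mor₂ ≫ (g - T.mor₃ ≫ l) := by
      rw [hg, Preadditive.comp_sub, ← Category.assoc, hw, zero_comp, sub_zero]
    rw [show e = e₁ ≫ e₂ from Subsingleton.elim _ _, F.map_comp, ← Category.assoc, hg',
      Category.assoc, hk, comp_zero]

omit [HasZeroObject C] [Pretriangulated C] in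
lemma approximates_addHull {I : C → Prop} {n : ℕ}
    (hI : ∀ X, I X → ∀ j : ℤ, Approximates H F a n (X⟦j⟧)) {X : C} (hX : addHull I X) :
    ∀ j : ℤ, Approximates H F a n (X⟦j⟧) := by
  induction hX with
  | of hX _ => exact hI _ hX
  | @shift X m _ _ ih =>
    intro j
    have e := (shiftFunctorAdd C m j).app X
    exact (ih (m + j)).retract e.inv e.hom e.inv_hom_id
  | sum i₁ i₂ p₁ p₂ h _ _ _ ih₁ ih₂ =>
    intro j
    refine (ih₁ j).sum (ih₂ j) (i₁⟦j⟧') (i₂⟦j⟧') (p₁⟦j⟧') (p₂⟦j⟧') ?_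
    rw [← Functor.map_comp, ← Functor.map_comp, ← Functor.map_add, h.2.2, CategoryTheory.Functor.map_id]
  | smd i p h _ _ ih =>
    intro j
    refine (ih j).retract (i⟦j⟧') (p⟦j⟧') ?_
    rw [← Functor.map_comp, h, CategoryTheory.Functor.map_id]

lemma exists_approximates_hullStep [Linear k C] (hH : Cohomological H)
    (ha : ∀ (i j : ℕ) (e : i ⟶ j), pull H (F.map e) (a j) = a i) {I : C → Prop} {n : ℕ}
    (hI : ∀ X, I X → ∀ j : ℤ, Approximates H F a n (X⟦j⟧)) (d : ℕ) :
    ∃ m, ∀ X, hullStep I d X → ∀ j : ℤ, Approximates H F a m (X⟦j⟧) := by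
  induction d with
  | zero =>
    exact ⟨0, fun X hX j => approximates_of_isZero ((shiftFunctor C j).map_isZero hX.1) 0⟩
  | succ d ih =>
    obtain ⟨m, hm⟩ := ih
    refine ⟨2 * max m n, fun X hX => approximates_addHull ?_ hX⟩
    rintro Y ⟨X₁, X₂, f, g, h, -, hX₁, hX₂, hT⟩ j
    have H₁ : ∀ j : ℤ, Approximates H F a (max m n) (X₁⟦j⟧) :=
      fun j => (hm _ hX₁ j).mono (le_max_left _ _)
    have H₂ : ∀ j : ℤ, Approximates H F a (max m n) (X₂⟦j⟧) :=
      fun j => (approximates_addHull hI hX₂ j).mono (le_max_right _ _)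
    have e₁ := (shiftFunctorAdd C j 1).app X₁
    have e₂ := (shiftFunctorAdd C j (-1)).app X₂
    exact Approximates.ext₂ hH ha (Triangle.shift_distinguished _ hT j) (H₁ j)
      ((H₁ (j + 1)).retract e₁.inv e₁.hom e₁.inv_hom_id) (H₂ j)
      ((H₂ (j + -1)).retract e₂.inv e₂.hom e₂.inv_hom_id)

variable [Linear k C]

omit [HasZeroObject C] [∀ n : ℤ, (shiftFunctor C n).Additive] [Pretriangulated C]
  [H.Additive] in
lemma LocFinGen.exists_element (h : LocFinGen H) (G : C) :
    ∃ (D : C) (b : H.obj (Opposite.op D)), ∀ (j : ℤ) (x : H.obj (Opposite.op (G⟦j⟧))),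
      ∃ f : G⟦j⟧ ⟶ D, pull H f b = x := by
  obtain ⟨D, α, hα⟩ := h G
  refine ⟨D, (α.app (Opposite.op D)).hom (𝟙 D), fun j x => ?_⟩
  obtain ⟨f, hf⟩ := hα j x
  exact ⟨f, (app_eq_pull H α f).symm.trans hf⟩

/-- Passing to a cone kills the elements of `h_D(G⟦j⟧)` that vanish in `H`. -/
lemma LocFinPres.exists_extension
    (hlin : ∀ (X Y : C) (c : k) (f : X ⟶ Y), H.map (c • f).op = c • H.map f.op)
    (hH : Cohomological H) (h : LocFinPres H) (G D : C) (b : H.obj (Opposite.op D)) :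
    ∃ (D' : C) (b' : H.obj (Opposite.op D')) (φ : D ⟶ D'), pull H φ b' = b ∧
      ∀ (j : ℤ) (f : G⟦j⟧ ⟶ D), pull H f b = 0 → f ≫ φ = 0 := by
  obtain ⟨E, f, hf, hE⟩ := h.2 D (ofElement H hlin b) G
  obtain ⟨D', φ, ψ, hT⟩ := distinguished_cocone_triangle f
  have hfb : pull H f b = 0 := by
    have h0 := ConcreteCategory.congr_hom (NatTrans.congr_app hf (Opposite.op E)) (𝟙 E)
    have h1 : pull H (𝟙 E ≫ f) b = 0 := h0
    rwa [Category.id_comp] at h1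
  obtain ⟨b', hb'⟩ := hH.exists_pull hT b hfb
  refine ⟨D', b', φ, hb', fun j y hy => ?_⟩
  obtain ⟨g, rfl⟩ := hE j y hy
  have hw : f ≫ φ = 0 := comp_distTriang_mor_zero₁₂ _ hT
  rw [Category.assoc, hw, comp_zero]

lemma LocFinPres.exists_approximation
    (hlin : ∀ (X Y : C) (c : k) (f : X ⟶ Y), H.map (c • f).op = c • H.map f.op)
    (hH : Cohomological H) (h : LocFinPres H) (G : C) :
    ∃ (F : ℕ ⥤ C) (a : ∀ i, H.obj (Opposite.op (F.obj i))),
      (∀ (i j : ℕ) (e : i ⟶ j), pull H (F.map e) (a j) = a i) ∧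
      ∀ j : ℤ, Approximates H F a 1 (G⟦j⟧) := by
  obtain ⟨D₀, b₀, h₀⟩ := h.1.exists_element G
  choose D' b' φ hφ hφ' using h.exists_extension hlin hH G
  let S : ℕ → Σ D : C, H.obj (Opposite.op D) :=
    fun n => Nat.rec ⟨D₀, b₀⟩ (fun _ p => ⟨D' p.1 p.2, b' p.1 p.2⟩) n
  let F : ℕ ⥤ C := Functor.ofSequence (X := fun n => (S n).1) fun n => φ (S n).1 (S n).2
  let a : ∀ i, H.obj (Opposite.op (F.obj i)) := fun i => (S i).2
  have hF : ∀ i, F.map (homOfLE (Nat.le_add_right i 1)) = φ (S i).1 (S i).2 :=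
    fun i => Functor.ofSequence_map_homOfLE_succ _ i
  have ha : ∀ (i j : ℕ) (e : i ⟶ j), pull H (F.map e) (a j) = a i := by
    intro i j e
    obtain ⟨l, rfl⟩ := Nat.exists_eq_add_of_le (leOfHom e)
    induction l with
    | zero =>
      rw [show e = 𝟙 i from Subsingleton.elim _ _, F.map_id]
      exact pull_id H _
    | succ l ih =>
      let e₁ : i ⟶ i + l := homOfLE (by omega)
      rw [show e = e₁ ≫ homOfLE (Nat.le_add_right (i + l) 1) from Subsingleton.elim _ _,
        F.map_comp, pull_comp, hF]
      exact (congrArg (pull H (F.map e₁)) (hφ _ _)).trans (ih e₁)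
  refine ⟨F, a, ha, fun j => ⟨fun i _ x => ?_, fun i l e hil f hf => ?_⟩⟩
  · obtain ⟨f, hf⟩ := h₀ j x
    let e : 0 ⟶ i := homOfLE (Nat.zero_le i)
    let f' : G⟦j⟧ ⟶ F.obj 0 := f
    refine ⟨f' ≫ F.map e, ?_⟩
    rw [pull_comp, ha]
    exact hf
  · let e₂ : i + 1 ⟶ l := homOfLE hil
    rw [show e = homOfLE (Nat.le_add_right i 1) ≫ e₂ from Subsingleton.elim _ _, F.map_comp,
      ← Category.assoc]
    have h0 : f ≫ F.map (homOfLE (Nat.le_add_right i 1)) = 0 :=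
      (congrArg (f ≫ ·) (hF i)).trans (hφ' _ _ j f hf)
    rw [h0, zero_comp]

omit [HasZeroObject C] [HasShift C ℤ] [∀ n : ℤ, (shiftFunctor C n).Additive]
  [Pretriangulated C] in
lemma exists_section_of_approximates
    (hlin : ∀ (X Y : C) (c : k) (f : X ⟶ Y), H.map (c • f).op = c • H.map f.op)
    (ha : ∀ (i j : ℕ) (e : i ⟶ j), pull H (F.map e) (a j) = a i) {n : ℕ}
    (hn : ∀ X : C, Approximates H F a n X) :
    ∃ (D : C) (s : H ⟶ (linearYoneda k C).obj D) (t : (linearYoneda k C).obj D ⟶ H),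
      s ≫ t = 𝟙 H := by
  choose r hr using fun (X : C) (x : H.obj (Opposite.op X)) => (hn X).1 n le_rfl x
  let e : n ⟶ n + n := homOfLE (by omega)
  have key : ∀ {X : C} (f g : X ⟶ F.obj n), pull H f (a n) = pull H g (a n) →
      f ≫ F.map e = g ≫ F.map e := by
    intro X f g hfg
    rw [← sub_eq_zero, ← Preadditive.sub_comp]
    exact (hn X).2 _ _ e le_rfl _ (by rw [sub_pull, hfg, sub_self])
  let s : H ⟶ (linearYoneda k C).obj (F.obj (n + n)) :=
    { app X := ModuleCat.ofHom (X := H.obj X) (Y := (X.unop ⟶ F.obj (n + n)))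
        { toFun x := r X.unop x ≫ F.map e
          map_add' x y := by
            rw [← Preadditive.add_comp]
            exact key _ _ (by rw [add_pull, hr, hr, hr])
          map_smul' c x := by
            rw [RingHom.id_apply, ← Linear.smul_comp]
            refine key _ _ ?_
            rw [hr]
            change _ = (H.map (c • r X.unop x).op).hom (a n)
            rw [hlin]
            exact congrArg (c • ·) (hr X.unop x).symm }
      naturality X Y f := by
        ext x
        change r Y.unop (pull H f.unop x) ≫ F.map e = f.unop ≫ r X.unop x ≫ F.map e
        rw [← Category.assoc]
        exact key _ _ (by rw [pull_comp, hr, hr]) }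
  refine ⟨F.obj (n + n), s, ofElement H hlin (a (n + n)), ?_⟩
  ext X x
  change pull H (r X.unop x ≫ F.map e) (a (n + n)) = x
  rw [pull_comp, ha, hr]

omit [H.Additive] in
lemma locFinPres_of_summand {D : C} (s : H ⟶ (linearYoneda k C).obj D)
    (t : (linearYoneda k C).obj D ⟶ H) (hst : s ≫ t = 𝟙 H) : LocFinPres H := by
  refine ⟨fun X => ⟨D, t, fun i x => ⟨(s.app _).hom x, ?_⟩⟩, fun E β X => ?_⟩
  · exact ConcreteCategory.congr_hom (NatTrans.congr_app hst _) x
  · obtain ⟨g, hg⟩ := (linearYoneda k C).map_surjective (β ≫ s)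
    obtain ⟨E', f, h, hT⟩ := distinguished_cocone_triangle₁ g
    have hw : f ≫ g = 0 := comp_distTriang_mor_zero₁₂ _ hT
    refine ⟨E', f, ?_, fun i y hy => ?_⟩
    · rw [← Category.comp_id β, ← hst, ← Category.assoc β, ← hg, ← Category.assoc,
        ← Functor.map_comp, hw]
      ext Y q
      exact (congrArg (t.app Y).hom (comp_zero (f := (q : Y.unop ⟶ E')))).trans
        (map_zero (t.app Y).hom)
    · have hy' : y ≫ g = 0 := by
        have h1 := ConcreteCategory.congr_hom (NatTrans.congr_app hg (Opposite.op (X⟦i⟧))) y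
        refine h1.trans ?_
        change (s.app _).hom (β.app _ y) = 0
        rw [hy]
        exact map_zero (s.app _).hom
      obtain ⟨q, hq⟩ := Triangle.coyoneda_exact₂ _ hT y hy'
      exact ⟨q, hq.symm⟩

end Approximation

end Rouquier

namespace Rouquier

/-- **Rouquier, Theorem 4.16 (representability for strongly finitely generated
triangulated categories).** Let `k` be a commutative ring and `T` a strongly finitely
generated `k`-linear triangulated category. A cohomological functor `H : Tᵒᵖ ⥤ k-Mod`
is locally finitely presented if and only if it is a direct summand of a representable
functor `h_C` for some object `C` of `T`. -/
theorem locFinPres_iff_summand_of_representable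
    {k : Type w} [CommRing k]
    {C : Type u} [Category.{v} C] [HasZeroObject C] [Preadditive C] [Linear k C]
    [HasShift C ℤ] [∀ n : ℤ, (shiftFunctor C n).Additive] [Pretriangulated C]
    (hsfg : ∃ (G : C) (d : ℕ), ∀ X : C, hullStep (fun Y => Y = G) d X)
    (H : Cᵒᵖ ⥤ ModuleCat.{v} k) [H.Additive]
    (hlin : ∀ (X Y : C) (c : k) (f : X ⟶ Y), H.map (c • f).op = c • H.map f.op)
    (hH : Cohomological H) :
    LocFinPres H ↔
      ∃ (D : C) (s : H ⟶ (linearYoneda k C).obj D) (t : (linearYoneda k C).obj D ⟶ H),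
        s ≫ t = 𝟙 H := by
  constructor
  · intro h
    obtain ⟨G, d, hG⟩ := hsfg
    obtain ⟨F, a, ha, hFG⟩ := h.exists_approximation hlin hH G
    obtain ⟨m, hm⟩ := exists_approximates_hullStep hH ha (I := fun Y => Y = G)
      (fun X hX j => hX ▸ hFG j) d
    refine exists_section_of_approximates hlin ha (n := m) fun X => ?_
    have e := (shiftFunctorZero C ℤ).app X
    exact (hm X (hG X) 0).retract e.inv e.hom e.inv_hom_id
  · rintro ⟨D, s, t, hst⟩
    exact locFinPres_of_summand s t hst

end Rouquier
end

section
/- Let k be a field and A a commutative local noetherian k-algebra with maximal ideal m. Then in the derived category D(A) of A-modules, the residue field A/m is not contained in ⟨A⟩_d for d = Krulldim A; that is, A/m cannot be obtained in at most Krulldim A extension steps from finite direct sums of shifts of A, even allowing direct summands. -/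
open CategoryTheory CategoryTheory.Limits CategoryTheory.Pretriangulated

universe w v u

namespace Rouquier

variable (A : Type u) [Ring A] [HasDerivedCategory.{v} (ModuleCat.{u} A)]

/-- The ring `A`, viewed as an object of the derived category of `A`-modules,
in degree `0`. -/
noncomputable def ringObj : DerivedCategory (ModuleCat.{u} A) :=
  (DerivedCategory.singleFunctor (ModuleCat.{u} A) 0).obj (ModuleCat.of A A)

/-- The objects of the derived category of `A`-modules which lie in `D^b(A-mod)` :
those whose cohomology is bounded and finitely generated in each degree. -/
def DbFgObj (X : DerivedCategory (ModuleCat.{u} A)) : Prop :=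
  (∃ a b : ℤ, ∀ n : ℤ, (n < a ∨ b < n) →
    IsZero ((DerivedCategory.homologyFunctor (ModuleCat.{u} A) n).obj X)) ∧
  (∀ n : ℤ, Module.Finite A
    ↥((DerivedCategory.homologyFunctor (ModuleCat.{u} A) n).obj X))

/-- The objects of the derived category of `A`-modules which lie in `D^b(A)` :
those with bounded cohomology. -/
def DbObj (X : DerivedCategory (ModuleCat.{u} A)) : Prop :=
  ∃ a b : ℤ, ∀ n : ℤ, (n < a ∨ b < n) →
    IsZero ((DerivedCategory.homologyFunctor (ModuleCat.{u} A) n).obj X)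

end Rouquier

namespace Rouquier

section GhostLemma

variable {C : Type u} [Category.{v} C] [Preadditive C] [HasShift C ℤ]

/-- Every morphism from a shift of `W` to `X` becomes zero after composition with `g`. -/
def IsGhostFor (W : C) {X Y : C} (g : X ⟶ Y) : Prop :=
  ∀ (n : ℤ) (f : W⟦n⟧ ⟶ X), f ≫ g = 0

namespace IsGhostFor

variable {W X Y Z : C} {g : X ⟶ Y}

lemma comp_right (h : IsGhostFor W g) (g' : Y ⟶ Z) : IsGhostFor W (g ≫ g') := fun n f => by
  rw [← Category.assoc, h n f, zero_comp]

lemma comp_eq_zero (h : IsGhostFor W g) (f : W ⟶ X) : f ≫ g = 0 := by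
  rw [← cancel_epi ((shiftFunctorZero C ℤ).hom.app W), comp_zero]
  simpa using h 0 ((shiftFunctorZero C ℤ).hom.app W ≫ f)

lemma shift_left (h : IsGhostFor W g) (m : ℤ) : IsGhostFor (W⟦m⟧) g := fun n f => by
  rw [← cancel_epi ((shiftFunctorAdd C m n).hom.app W), comp_zero]
  simpa using h (m + n) ((shiftFunctorAdd C m n).hom.app W ≫ f)

variable [∀ n : ℤ, (shiftFunctor C n).Additive]

lemma shift_right (h : IsGhostFor W g) (m : ℤ) : IsGhostFor W (g⟦m⟧') := fun n f => by
  let φ := (shiftFunctorAdd' C (n - m) m n (by lia)).app W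
  obtain ⟨f', hf'⟩ := (shiftFunctor C m).map_surjective (φ.inv ≫ f)
  have h0 := congrArg (shiftFunctor C m).map (h (n - m) f')
  rw [Functor.map_comp, hf', Functor.map_zero, Category.assoc] at h0
  rwa [← cancel_epi φ.inv, comp_zero]

lemma addHull {I : C → Prop} (h : ∀ W, I W → IsGhostFor W g) (hW : addHull I W) :
    IsGhostFor W g := by
  induction hW with
  | of hI _ => exact h _ hI
  | shift n _ _ ih => exact ih.shift_left n
  | sum i₁ i₂ p₁ p₂ hsum _ _ _ ih₁ ih₂ =>
    intro n f
    have : f = p₁⟦n⟧' ≫ i₁⟦n⟧' ≫ f + p₂⟦n⟧' ≫ i₂⟦n⟧' ≫ f := by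
      simp only [← Category.assoc, ← Preadditive.add_comp, ← Functor.map_comp, ← Functor.map_add,
        hsum.2.2, CategoryTheory.Functor.map_id, Category.id_comp]
    rw [this, Preadditive.add_comp]
    simp only [Category.assoc]
    rw [← Category.assoc (i₁⟦n⟧'), ih₁, ← Category.assoc (i₂⟦n⟧'), ih₂]
    simp
  | smd i p hip _ _ ih =>
    intro n f
    have : f = i⟦n⟧' ≫ p⟦n⟧' ≫ f := by
      rw [← Category.assoc, ← Functor.map_comp, hip, CategoryTheory.Functor.map_id, Category.id_comp]
    rw [this, Category.assoc, ih, comp_zero]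

variable [HasZeroObject C] [Pretriangulated C]

/-- If `g` is ghost for `I₁` and `g'` is ghost for `I₂`, then `g ≫ g'` is ghost for `I₁ ∗ I₂`. -/
lemma star {I₁ I₂ : C → Prop} {g' : Y ⟶ Z} (h₁ : ∀ W, I₁ W → IsGhostFor W g)
    (h₂ : ∀ W, I₂ W → IsGhostFor W g') (hW : star I₁ I₂ W) : IsGhostFor W (g ≫ g') := by
  obtain ⟨W₁, W₂, a, b, c, -, hW₁, hW₂, hT⟩ := hW
  intro n f
  obtain ⟨φ : W₂⟦n⟧ ⟶ Y, hφ : f ≫ g = (n.negOnePow • b⟦n⟧') ≫ φ⟩ :=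
    Triangle.yoneda_exact₂ _ (Triangle.shift_distinguished _ hT n) (f ≫ g) (by
      change (n.negOnePow • a⟦n⟧') ≫ f ≫ g = 0
      rw [← Category.assoc, h₁ _ hW₁ n])
  rw [← Category.assoc, hφ, Category.assoc, h₂ _ hW₂ n φ, comp_zero]

end IsGhostFor

end GhostLemma

section Ext

variable {A : Type u} [Ring A] [HasDerivedCategory.{w} (ModuleCat.{u} A)]

open DerivedCategory Abelian

/-- A class of degree one is a ghost for `A`. -/
lemma isGhostFor_ringObj_hom {K N : ModuleCat.{u} A} (γ : Ext K N 1) :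
    IsGhostFor (ringObj A) γ.hom := by
  intro n f
  obtain hn | hn := lt_or_ge 0 n
  · have : ((ringObj A)⟦n⟧).IsLE (-n) := by
      have : (ringObj A).IsLE 0 := by unfold ringObj; infer_instance
      exact TStructure.t.isLE_shift (ringObj A) 0 n (-n)
    rw [TStructure.t.zero f (-n) 0, zero_comp]
  · obtain ⟨m, rfl⟩ : ∃ m : ℕ, n = -m := ⟨n.natAbs, by lia⟩
    let φ : (ringObj A)⟦(-m : ℤ)⟧⟦(m : ℤ)⟧ ≅
        (singleFunctor (ModuleCat.{u} A) 0).obj (ModuleCat.of A A) :=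
      (shiftFunctorCompIsoId (DerivedCategory (ModuleCat.{u} A)) (-m : ℤ) m (by lia)).app
        (ringObj A)
    let β : Ext (ModuleCat.of A A) K m := Ext.homEquiv.symm (φ.inv ≫ f⟦(m : ℤ)⟧')
    have hβ : β.hom = φ.inv ≫ f⟦(m : ℤ)⟧' := Ext.homEquiv.apply_symm_apply _
    have h0 : (β.comp γ rfl).hom = 0 := by
      rw [Ext.eq_zero_of_projective (β.comp γ rfl), Ext.zero_hom]
    rw [Ext.comp_hom, ShiftedHom.comp, hβ, ← Category.assoc, Preadditive.IsIso.comp_right_eq_zero,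
      Category.assoc, ← Functor.map_comp] at h0
    apply (shiftFunctor _ (m : ℤ)).map_injective
    rw [Functor.map_zero]
    rwa [← cancel_epi φ.inv, comp_zero]

/-- A class of degree `d` is a ghost for the objects of `⟨A⟩_d`. -/
lemma isGhostFor_hom_of_hullStep (d : ℕ) {M N : ModuleCat.{u} A} (α : Ext M N d)
    {W : DerivedCategory (ModuleCat.{u} A)} (hW : hullStep (fun Y => Y = ringObj A) d W) :
    IsGhostFor W α.hom := by
  induction d generalizing N W with
  | zero => exact fun n f => ((shiftFunctor _ n).map_isZero hW.1).eq_of_src _ _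
  | succ d ih =>
    let ι : N ⟶ Injective.under N := Injective.ι N
    have hS : (ShortComplex.mk ι (cokernel.π ι) (cokernel.condition ι)).ShortExact :=
      { exact := ShortComplex.exact_cokernel ι
        mono_f := inferInstanceAs (Mono ι)
        epi_g := inferInstanceAs (Epi (cokernel.π ι)) }
    obtain ⟨β, rfl⟩ := Ext.covariant_sequence_exact₁ M hS α
      (Ext.eq_zero_of_injective (I := Injective.under N) _) rfl
    rw [Ext.comp_hom, ShiftedHom.comp, ← Category.assoc]
    refine IsGhostFor.comp_right (IsGhostFor.addHull (fun W' hW' => ?_) hW) _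
    refine IsGhostFor.star (fun _ => ih β) (fun V hV => ?_) hW'
    refine IsGhostFor.addHull ?_ hV
    rintro _ rfl
    exact (isGhostFor_ringObj_hom hS.extClass).shift_right _

end Ext

section LocalAlgebra

open Abelian

variable {A : Type u} [CommRing A]

/-- Nakayama's lemma at a prime `q`: if `E` is finitely generated, `x ∈ q` and `E / xE` vanishes
locally at `q`, then `E` vanishes locally at `q`. -/
lemma exists_smul_eq_zero_of_forall_exists_smul_eq_smul {E : Type v} [AddCommGroup E] [Module A E]
    [Module.Finite A E] {q : Ideal A} [q.IsPrime] {x : A} (hx : x ∈ q)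
    (h : ∀ e : E, ∃ s ∈ q.primeCompl, ∃ e' : E, s • e = x • e') (e : E) :
    ∃ s ∈ q.primeCompl, s • e = 0 := by
  have hsub : Subsingleton (LocalizedModule q.primeCompl E) := by
    rw [← Submodule.subsingleton_iff (Localization.AtPrime q), ← subsingleton_iff_bot_eq_top,
      eq_comm]
    refine Submodule.eq_bot_of_le_smul_of_le_jacobson_bot
      (IsLocalRing.maximalIdeal (Localization.AtPrime q)) _ Module.Finite.fg_top ?_
      (IsLocalRing.maximalIdeal_le_jacobson _)
    rintro y -
    induction y using LocalizedModule.induction_on with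
    | h e t =>
      obtain ⟨s, hs, e', hse⟩ := h e
      have hmem : algebraMap A (Localization.AtPrime q) x ∈
          IsLocalRing.maximalIdeal (Localization.AtPrime q) :=
        (IsLocalization.AtPrime.to_map_mem_maximal_iff _ q x).mpr hx
      have : LocalizedModule.mk e t = algebraMap A (Localization.AtPrime q) x •
          LocalizedModule.mk e' (⟨s, hs⟩ * t) := by
        rw [algebraMap_smul, LocalizedModule.smul'_mk, ← hse]
        exact (LocalizedModule.mk_cancel_common_left ⟨s, hs⟩ t e).symm
      rw [this]
      exact Submodule.smul_mem_smul hmem trivial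
  exact LocalizedModule.subsingleton_iff.mp hsub e

lemma mk₀_smul_id_comp {L N : ModuleCat.{u} A} {i : ℕ} (x : A) (e : Ext L N i) :
    (Ext.mk₀ (x • 𝟙 L)).comp e (zero_add i) = x • e := by
  rw [Ext.mk₀_smul, Ext.smul_comp, Ext.mk₀_id_comp]

variable (A) in
/-- The `i`-th Ext group of `L` with values in `N` vanishes locally at the ideal `q`. -/
def ExtVanishesAt (q : Ideal A) [q.IsPrime] (i : ℕ) (N : ModuleCat.{u} A)
    (L : Type u) [AddCommGroup L] [Module A L] : Prop :=
  ∀ e : Ext (ModuleCat.of A L) N i, ∃ s ∈ q.primeCompl, s • e = 0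

variable {q : Ideal A} [q.IsPrime] {i : ℕ} {N : ModuleCat.{u} A}

lemma ExtVanishesAt.of_linearEquiv {L L' : Type u} [AddCommGroup L] [Module A L]
    [AddCommGroup L'] [Module A L'] (φ : L ≃ₗ[A] L') (h : ExtVanishesAt A q i N L) :
    ExtVanishesAt A q i N L' := by
  intro e
  obtain ⟨s, hs, hse⟩ := h ((Ext.mk₀ φ.toModuleIso.hom).comp e (zero_add i))
  refine ⟨s, hs, ?_⟩
  have : (Ext.mk₀ φ.toModuleIso.inv).comp
      (s • (Ext.mk₀ φ.toModuleIso.hom).comp e (zero_add i)) (zero_add i) = 0 := by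
    rw [hse, Ext.comp_zero]
  rwa [Ext.comp_smul, Ext.mk₀_comp_mk₀_assoc, Iso.inv_hom_id, Ext.mk₀_id_comp] at this

lemma ExtVanishesAt.of_smul_eq_zero {L : Type u} [AddCommGroup L] [Module A L] {s : A}
    (hs : s ∈ q.primeCompl) (h : ∀ l : L, s • l = 0) : ExtVanishesAt A q i N L := by
  intro e
  refine ⟨s, hs, ?_⟩
  have h0 : s • 𝟙 (ModuleCat.of A L) = 0 := by
    ext l
    exact h l
  rw [← mk₀_smul_id_comp, h0, Ext.mk₀_zero, Ext.zero_comp]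

lemma ExtVanishesAt.of_shortExact {S : ShortComplex (ModuleCat.{u} A)} (hS : S.ShortExact)
    (h₁ : ExtVanishesAt A q i N S.X₁) (h₃ : ExtVanishesAt A q i N S.X₃) :
    ExtVanishesAt A q i N S.X₂ := by
  intro e
  obtain ⟨s, hs, hse⟩ := h₁ ((Ext.mk₀ S.f).comp e (zero_add i))
  rw [← Ext.comp_smul] at hse
  obtain ⟨e', he'⟩ := Ext.contravariant_sequence_exact₂ hS _ _ hse
  obtain ⟨t, ht, hte⟩ := h₃ e'
  refine ⟨t * s, mul_mem ht hs, ?_⟩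
  rw [mul_smul, ← he', ← Ext.comp_smul, hte, Ext.comp_zero]

/-- If `q` is the only prime between `I` and `q`, local vanishing of Ext at `q` passes from `A / q`
to all finitely generated modules killed by `I`. -/
lemma ExtVanishesAt.of_le_annihilator [IsNoetherianRing A] {I : Ideal A}
    (hI : ∀ p : Ideal A, p.IsPrime → I ≤ p → p ≤ q → p = q)
    (hq : ExtVanishesAt A q i N (A ⧸ q)) (L : Type u) [AddCommGroup L] [Module A L]
    [hL : Module.Finite A L] (hIL : I ≤ Module.annihilator A L) :
    ExtVanishesAt A q i N L := by
  induction hL using IsNoetherianRing.induction_on_isQuotientEquivQuotientPrime A with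
  | subsingleton L =>
    exact .of_smul_eq_zero q.primeCompl.one_mem fun _ => Subsingleton.elim _ _
  | quotient L p φ =>
    have hIp : I ≤ p.1 := by
      rwa [φ.annihilator_eq, Ideal.annihilator_quotient] at hIL
    by_cases hpq : p.1 ≤ q
    · obtain rfl := hI p.1 p.2 hIp hpq
      exact hq.of_linearEquiv φ.symm
    · obtain ⟨s, hsp, hsq⟩ := SetLike.not_le_iff_exists.mp hpq
      refine .of_smul_eq_zero (s := s) hsq fun l => ?_
      have : s ∈ Module.annihilator A L := by
        rwa [φ.annihilator_eq, Ideal.annihilator_quotient]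
      exact Module.mem_annihilator.mp this l
  | exact N₁ N₂ N₃ f g hf hg hfg ih₁ ih₃ =>
    let S : ShortComplex (ModuleCat.{u} A) :=
      .mk (ModuleCat.ofHom f) (ModuleCat.ofHom g) (by ext x; exact hfg.apply_apply_eq_zero x)
    have hS : S.ShortExact :=
      { exact := (ShortComplex.ShortExact.moduleCat_exact_iff_function_exact S).mpr hfg
        mono_f := (ModuleCat.mono_iff_injective _).mpr hf
        epi_g := (ModuleCat.epi_iff_surjective _).mpr hg }
    exact ExtVanishesAt.of_shortExact hS
      (ih₁ (hIL.trans (f.annihilator_le_of_injective hf)))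
      (ih₃ (hIL.trans (g.annihilator_le_of_surjective hg)))

/-- Bass' lemma: for adjacent primes `p < q`, if `Ext^{i+1}(A/q, N)` vanishes at `q` then
`Ext^i(A/p, N)` vanishes at `p`. -/
lemma ExtVanishesAt.of_covBy [IsNoetherianRing A] [Module.Finite A N] {p : Ideal A} [p.IsPrime]
    (hpq : p < q) (hcov : ∀ p' : Ideal A, p'.IsPrime → p < p' → ¬ p' < q)
    (h : ExtVanishesAt A q (i + 1) N (A ⧸ q)) : ExtVanishesAt A p i N (A ⧸ p) := by
  obtain ⟨x, hxq, hxp⟩ := SetLike.exists_of_lt hpq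
  have hreg : IsSMulRegular (A ⧸ p) x := by
    intro a b hab
    induction a using Submodule.Quotient.induction_on with | _ a
    induction b using Submodule.Quotient.induction_on with | _ b
    change Submodule.Quotient.mk (x • a) = Submodule.Quotient.mk (x • b) at hab
    rw [Submodule.Quotient.eq, ← smul_sub] at hab
    exact (Submodule.Quotient.eq p).mpr
      ((Ideal.IsPrime.mem_or_mem ‹_› hab).resolve_left hxp)
  have hS := IsSMulRegular.smulShortComplex_shortExact
    (M := ModuleCat.of A (A ⧸ p)) hreg
  have hquot : ExtVanishesAt A q (i + 1) N (QuotSMulTop x (A ⧸ p)) := by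
    refine h.of_le_annihilator (I := p ⊔ Ideal.span {x}) (fun p' hp' hle hle' => ?_) _ ?_
    · have hlt : p < p' := lt_of_le_of_ne (le_sup_left.trans hle) fun heq =>
        hxp (heq ▸ hle (Ideal.mem_sup_right (Ideal.mem_span_singleton_self x)))
      exact eq_of_le_of_not_lt hle' (hcov p' hp' hlt)
    · refine sup_le ?_ ?_
      · exact (Ideal.annihilator_quotient (I := p)).ge.trans
          ((Submodule.mkQ _).annihilator_le_of_surjective (Submodule.mkQ_surjective _))
      · rw [Ideal.span_singleton_le_iff_mem, Module.mem_annihilator]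
        intro m
        induction m using Submodule.Quotient.induction_on with | _ m
        exact (Submodule.Quotient.mk_eq_zero _).mpr
          (Submodule.smul_mem_pointwise_smul _ _ _ trivial)
  intro e
  obtain ⟨s, hs, hse⟩ := exists_smul_eq_zero_of_forall_exists_smul_eq_smul hxq
    (E := Ext (ModuleCat.of A (A ⧸ p)) N i) (fun e => by
      obtain ⟨s, hs, hse⟩ := hquot (hS.extClass.comp e (add_comm 1 i))
      obtain ⟨e', he'⟩ := Ext.contravariant_sequence_exact₁ hS _ (s • e) (add_comm 1 i)
        ((Ext.comp_smul _ _ _ _).trans hse)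
      refine ⟨s, hs, e', ?_⟩
      rw [ModuleCat.smulShortComplex_f_eq_smul_id] at he'
      exact he'.symm.trans (mk₀_smul_id_comp x e')) e
  exact ⟨s, fun hsp => hs (hpq.le hsp), hse⟩

lemma exists_not_extVanishesAt_of_height_eq [IsNoetherianRing A] (q : Ideal A) [q.IsPrime] (i : ℕ)
    (hq : q.height = i) :
    ∃ N : ModuleCat.{u} A, Module.Finite A N ∧ ¬ ExtVanishesAt A q i N (A ⧸ q) := by
  induction i generalizing q with
  | zero =>
    refine ⟨ModuleCat.of A (A ⧸ q), inferInstanceAs (Module.Finite A (A ⧸ q)), fun h => ?_⟩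
    obtain ⟨s, hs, hse⟩ := h (Ext.mk₀ (𝟙 _))
    rw [← Ext.mk₀_smul, Ext.mk₀_eq_zero_iff] at hse
    refine hs (Ideal.Quotient.eq_zero_iff_mem.mp ?_)
    have := ConcreteCategory.congr_hom hse (1 : A ⧸ q)
    simpa [Algebra.smul_def] using this
  | succ i ih =>
    have hlt : ¬ q.height ≤ i := by
      rw [hq, not_le]
      exact_mod_cast i.lt_succ_self
    rw [Ideal.height_le_iff_covBy] at hlt
    push Not at hlt
    obtain ⟨p, hp, hpq, hcov, hle⟩ := hlt
    have hheight : p.height ≤ i := by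
      have := (Ideal.height_le_iff (p := q) (n := i + 1)).mp (by rw [hq]) p hp hpq
      push_cast at this
      exact Order.le_of_lt_add_one this
    obtain ⟨N, hN, hNp⟩ := ih p (le_antisymm hheight hle)
    exact ⟨N, hN, fun h => hNp (h.of_covBy hpq hcov)⟩

/-- For a noetherian local ring of Krull dimension `d`, some `Ext^d(A/m, N)` is nonzero. -/
lemma exists_ext_residueField_ne_zero [IsLocalRing A] [IsNoetherianRing A] (d : ℕ)
    (hd : ringKrullDim A = d) :
    ∃ (N : ModuleCat.{u} A) (e : Ext (ModuleCat.of A (IsLocalRing.ResidueField A)) N d), e ≠ 0 := by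
  have hheight : (IsLocalRing.maximalIdeal A).height = d := by
    have := IsLocalRing.maximalIdeal_height_eq_ringKrullDim (R := A)
    rw [hd] at this
    exact_mod_cast this
  obtain ⟨N, -, hN⟩ := exists_not_extVanishesAt_of_height_eq _ d hheight
  by_contra! h
  exact hN fun e => ⟨1, one_mem _, by rw [one_smul]; exact h N e⟩

end LocalAlgebra

/-- **Rouquier, Proposition 5.36.** Let `k` be a field and `A` a commutative local
noetherian `k`-algebra with maximal ideal `m` and Krull dimension `d`. Then, in the
derived category `D(A)`, the residue field `A/m` does not belong to `⟨A⟩_d` : it cannot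
be obtained in at most `d` extension steps from finite direct sums of shifts of `A`,
even allowing direct summands. -/
theorem residueField_not_mem_hull_krullDim
    (k : Type u) [Field k] (A : Type u) [CommRing A] [Algebra k A]
    [IsLocalRing A] [IsNoetherianRing A]
    [HasDerivedCategory.{w} (ModuleCat.{u} A)]
    (d : ℕ) (hd : ringKrullDim A = (d : WithBot ℕ∞)) :
    ¬ hullStep (fun Y => Y = ringObj A) d
        ((DerivedCategory.singleFunctor (ModuleCat.{u} A) 0).obj
          (ModuleCat.of A (IsLocalRing.ResidueField A))) := by
  intro h
  obtain ⟨N, e, he⟩ := exists_ext_residueField_ne_zero d hd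
  refine he (Abelian.Ext.ext ?_)
  rw [Abelian.Ext.zero_hom]
  simpa using (isGhostFor_hom_of_hullStep d e h).comp_eq_zero (𝟙 _)

end Rouquier
end

section
/- Let A be an artinian ring with Jacobson radical J(A) and Loewy length ll(A) (the smallest i with J(A)^i = 0). Then D^b(A-mod) = ⟨A/J(A)⟩_{ll(A)}; in particular, the dimension of the bounded derived category D^b(A-mod) of finitely generated A-modules is at most ll(A) − 1. -/
open CategoryTheory CategoryTheory.Limits CategoryTheory.Pretriangulated

universe w v u

namespace Rouquier

/-- The Jacobson radical of the ring `A`. -/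
def jrad (A : Type u) [Ring A] : Ideal A := Ideal.jacobson (⊥ : Ideal A)

/-- `J(A)^i = 0` : any product of `i` elements of the Jacobson radical vanishes. -/
def LoewyVanish (A : Type u) [Ring A] (i : ℕ) : Prop :=
  ∀ x : Fin i → A, (∀ j, x j ∈ jrad A) → (List.ofFn x).prod = 0

end Rouquier

namespace Rouquier

section Hull

lemma addHullIn.of_iso {C : Type u} [Category.{v} C] [Preadditive C] [HasShift C ℤ]
    {S I : C → Prop} {X Y : C} (h : addHullIn S I X) (e : X ≅ Y) (hY : S Y) :
    addHullIn S I Y :=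
  .smd e.inv e.hom e.inv_hom_id h hY

variable {C : Type u} [Category.{v} C] [HasZeroObject C] [Preadditive C]
  [HasShift C ℤ] [∀ n : ℤ, (shiftFunctor C n).Additive] [Pretriangulated C]

/-- A class of objects closed under the operations which are used in order to define hulls. -/
structure IsThickClass (S : C → Prop) : Prop where
  zero {X : C} : IsZero X → S X
  shift {X : C} (n : ℤ) : S X → S (X⟦n⟧)
  sum {X Y Z : C} (i₁ : X ⟶ Z) (i₂ : Y ⟶ Z) (p₁ : Z ⟶ X) (p₂ : Z ⟶ Y) :
    IsDirSum i₁ i₂ p₁ p₂ → S X → S Y → S Z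
  smd {X Y : C} (i : Y ⟶ X) (p : X ⟶ Y) : i ≫ p = 𝟙 Y → S X → S Y
  ext (T : Triangle C) : T ∈ distTriang C → S T.obj₁ → S T.obj₃ → S T.obj₂

namespace IsThickClass

variable {S : C → Prop}

lemma addHullIn_of_addHull (hS : IsThickClass S) {I I' : C → Prop}
    (hI : ∀ X, I X → I' X ∧ S X) {X : C} (hX : addHull I X) : addHullIn S I' X ∧ S X := by
  induction hX with
  | of h _ => exact ⟨.of (hI _ h).1 (hI _ h).2, (hI _ h).2⟩
  | shift n _ _ ih => exact ⟨.shift n ih.1 (hS.shift n ih.2), hS.shift n ih.2⟩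
  | sum i₁ i₂ p₁ p₂ h _ _ _ ih₁ ih₂ =>
    have := hS.sum i₁ i₂ p₁ p₂ h ih₁.2 ih₂.2
    exact ⟨.sum i₁ i₂ p₁ p₂ h ih₁.1 ih₂.1 this, this⟩
  | smd i p h _ _ ih => exact ⟨.smd i p h ih.1 (hS.smd i p h ih.2), hS.smd i p h ih.2⟩

lemma hullStepIn_of_hullStep (hS : IsThickClass S) {I : C → Prop} (hI : ∀ X, I X → S X)
    (d : ℕ) {X : C} (hX : hullStep I d X) : hullStepIn S I d X ∧ S X := by
  induction d generalizing X with
  | zero => exact ⟨⟨hX.1, hS.zero hX.1⟩, hS.zero hX.1⟩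
  | succ d ih =>
    refine hS.addHullIn_of_addHull ?_ hX
    rintro Y ⟨X₁, X₂, f, g, h, -, h₁, h₂, hT⟩
    have h₁' := ih h₁
    have h₂' := hS.addHullIn_of_addHull (fun Z hZ ↦ ⟨hZ, hI Z hZ⟩) h₂
    have hY : S Y := hS.ext _ hT h₁'.2 h₂'.2
    exact ⟨⟨X₁, X₂, f, g, h, hY, h₁'.1, h₂'.1, hT⟩, hY⟩

end IsThickClass

lemma hullStepIn_le {S I : C → Prop} (d : ℕ) {X : C} (hX : hullStepIn S I d X) : S X := by
  cases d with
  | zero => exact hX.2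
  | succ d => cases hX <;> assumption

end Hull

section Closure

variable (A : Type u) [Ring A]

lemma moduleFinite_of_exact [IsNoetherianRing A] {S : ShortComplex (ModuleCat.{u} A)}
    (hS : S.Exact) [Module.Finite A S.X₁] [Module.Finite A S.X₃] : Module.Finite A S.X₂ := by
  have h := hS.moduleCat_range_eq_ker
  have : IsNoetherian A S.X₂ := isNoetherian_of_range_eq_ker S.f.hom S.g.hom h
  infer_instance

variable [HasDerivedCategory.{v} (ModuleCat.{u} A)]

open DerivedCategory

lemma isThickClass_dbFgObj [IsNoetherianRing A] : IsThickClass (DbFgObj A) where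
  zero {X} hX := by
    have h (n : ℤ) := (homologyFunctor (ModuleCat.{u} A) n).map_isZero hX
    refine ⟨⟨0, 0, fun n _ ↦ h n⟩, fun n ↦ ?_⟩
    have := ModuleCat.subsingleton_of_isZero (h n)
    infer_instance
  shift {X} n := by
    rintro ⟨⟨a, b, hab⟩, hX⟩
    have e (i : ℤ) : (homologyFunctor (ModuleCat.{u} A) i).obj (X⟦n⟧) ≅
        (homologyFunctor (ModuleCat.{u} A) (n + i)).obj X :=
      ((homologyFunctor (ModuleCat.{u} A) 0).shiftIso n i (n + i) rfl).app X
    refine ⟨⟨a - n, b - n, fun i hi ↦ (hab (n + i) (by lia)).of_iso (e i)⟩, fun i ↦ ?_⟩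
    have := hX (n + i)
    exact Module.Finite.equiv (e i).symm.toLinearEquiv
  sum {X Y Z} i₁ i₂ p₁ p₂ h := by
    rintro ⟨⟨a, b, hab⟩, hX⟩ ⟨⟨a', b', hab'⟩, hY⟩
    have hZ (n : ℤ) := (homologyFunctor (ModuleCat.{u} A) n).congr_map h.2.2
    simp only [Functor.map_add, Functor.map_comp, CategoryTheory.Functor.map_id] at hZ
    refine ⟨⟨min a a', max b b', fun n hn ↦ ?_⟩, fun n ↦ ?_⟩
    · rw [IsZero.iff_id_eq_zero, ← hZ, (hab n (by lia)).eq_of_tgt ((homologyFunctor _ n).map p₁) 0,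
        (hab' n (by lia)).eq_of_tgt ((homologyFunctor _ n).map p₂) 0]
      simp
    · have := hX n
      have := hY n
      let H := homologyFunctor (ModuleCat.{u} A) n
      refine Module.Finite.of_surjective ((H.map i₁).hom.coprod (H.map i₂).hom) fun z ↦
        ⟨((H.map p₁).hom z, (H.map p₂).hom z), ?_⟩
      have := congr($(hZ n).hom z)
      simpa using this
  smd {X Y} i p h := by
    rintro ⟨⟨a, b, hab⟩, hX⟩
    have hY (n : ℤ) := (homologyFunctor (ModuleCat.{u} A) n).congr_map h
    simp only [Functor.map_comp, CategoryTheory.Functor.map_id] at hY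
    refine ⟨⟨a, b, fun n hn ↦ ?_⟩, fun n ↦ ?_⟩
    · rw [IsZero.iff_id_eq_zero, ← hY, (hab n hn).eq_of_tgt ((homologyFunctor _ n).map i) 0,
        zero_comp]
    · have := hX n
      refine Module.Finite.of_surjective ((homologyFunctor (ModuleCat.{u} A) n).map p).hom
        fun z ↦ ⟨((homologyFunctor (ModuleCat.{u} A) n).map i).hom z, ?_⟩
      have := congr($(hY n).hom z)
      simpa using this
  ext T hT := by
    rintro ⟨⟨a, b, hab⟩, hX⟩ ⟨⟨a', b', hab'⟩, hY⟩
    refine ⟨⟨min a a', max b b', fun n hn ↦ ?_⟩, fun n ↦ ?_⟩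
    · exact (HomologySequence.exact₂ T hT n).isZero_of_both_zeros
        ((hab n (by lia)).eq_of_src _ _) ((hab' n (by lia)).eq_of_tgt _ _)
    · have := hX n
      have := hY n
      exact moduleFinite_of_exact A (HomologySequence.exact₂ T hT n)

/-- The `n`th homology of an object concentrated in degree `n`. -/
noncomputable def homologySingleIso (M : ModuleCat.{u} A) (n : ℤ) :
    (homologyFunctor (ModuleCat.{u} A) n).obj ((singleFunctor _ n).obj M) ≅ M :=
  (homologyFunctor (ModuleCat.{u} A) n).mapIso ((singleFunctorIsoCompQ _ n).app M) ≪≫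
    (homologyFunctorFactors _ n).app _ ≪≫
    HomologicalComplex.singleObjHomologySelfIso (ComplexShape.up ℤ) n M

lemma isZero_homology_single (M : ModuleCat.{u} A) {n m : ℤ} (h : m ≠ n) :
    IsZero ((homologyFunctor (ModuleCat.{u} A) m).obj ((singleFunctor _ n).obj M)) := by
  rcases lt_or_gt_of_ne h with h | h
  · exact isZero_of_isGE _ n m h
  · exact isZero_of_isLE _ n m h

lemma dbFgObj_single (M : ModuleCat.{u} A) [Module.Finite A M] (n : ℤ) :
    DbFgObj A ((singleFunctor _ n).obj M) := by
  refine ⟨⟨n, n, fun m hm ↦ isZero_homology_single A M (by lia)⟩, fun m ↦ ?_⟩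
  by_cases h : m = n
  · subst h
    exact Module.Finite.equiv (homologySingleIso A M m).symm.toLinearEquiv
  · have := ModuleCat.subsingleton_of_isZero (isZero_homology_single A M h)
    infer_instance

end Closure

section Semisimple

variable {A : Type u} [Ring A]

instance : (jrad A).IsTwoSided := inferInstanceAs (Ideal.jacobson (⊥ : Ideal A)).IsTwoSided

instance [IsArtinianRing A] : IsSemisimpleRing (A ⧸ jrad A) := by
  have h : IsSemisimpleRing (A ⧸ Ring.jacobson A) := inferInstance
  exact (Ideal.quotEquivOfEq Ideal.jacobson_bot.symm).isSemisimpleRing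

/-- The modules annihilated by the Jacobson radical. -/
abbrev IsRadTorsion (A : Type u) [Ring A] (M : Type*) [AddCommGroup M] [Module A M] : Prop :=
  Module.IsTorsionBySet A M (jrad A : Set A)

section

variable {M N : Type*} [AddCommGroup M] [Module A M] [AddCommGroup N] [Module A N]

lemma IsRadTorsion.of_injective (hN : IsRadTorsion A N) (f : M →ₗ[A] N)
    (hf : Function.Injective f) : IsRadTorsion A M := fun x a ↦
  hf (by rw [map_smul, map_zero]; exact @hN (f x) a)

lemma IsRadTorsion.of_surjective (hM : IsRadTorsion A M) (f : M →ₗ[A] N)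
    (hf : Function.Surjective f) : IsRadTorsion A N := fun y a ↦ by
  obtain ⟨x, rfl⟩ := hf y
  rw [← map_smul, @hM x a, map_zero]

variable [IsArtinianRing A]

lemma IsRadTorsion.isSemisimpleModule (hM : IsRadTorsion A M) : IsSemisimpleModule A M := by
  let := hM.module
  exact hM.isSemisimpleModule_iff.1 inferInstance

lemma IsRadTorsion.exists_retract (hM : IsRadTorsion A M) [Module.Finite A M] :
    ∃ (k : ℕ) (i : M →ₗ[A] Fin k → A ⧸ jrad A) (p : (Fin k → A ⧸ jrad A) →ₗ[A] M),
      p ∘ₗ i = LinearMap.id := by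
  let := hM.module
  have : IsScalarTower A (A ⧸ jrad A) M := hM.isScalarTower
  have : Module.Finite (A ⧸ jrad A) M := .of_restrictScalars_finite A _ _
  obtain ⟨k, p, hp⟩ := Module.Finite.exists_fin' (A ⧸ jrad A) M
  obtain ⟨i, hi⟩ := IsSemisimpleModule.lifting_property p hp LinearMap.id
  refine ⟨k, i.restrictScalars A, p.restrictScalars A, ?_⟩
  ext x
  exact congr($hi x)

end

variable [HasDerivedCategory.{w} (ModuleCat.{u} A)]

open DerivedCategory

variable (A) in
/-- The semisimple quotient of `A`, in degree `0`. -/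
abbrev IsSemisimpleQuotient (Y : DerivedCategory (ModuleCat.{u} A)) : Prop :=
  Y = (singleFunctor (ModuleCat.{u} A) 0).obj (ModuleCat.of A (A ⧸ jrad A))

lemma addHull_single_of_retract {M N : ModuleCat.{u} A} (i : N ⟶ M) (p : M ⟶ N)
    (h : i ≫ p = 𝟙 N)
    (hM : addHull (IsSemisimpleQuotient A) ((singleFunctor (ModuleCat.{u} A) 0).obj M)) :
    addHull (IsSemisimpleQuotient A) ((singleFunctor (ModuleCat.{u} A) 0).obj N) :=
  .smd ((singleFunctor _ 0).map i) ((singleFunctor _ 0).map p)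
    (by rw [← Functor.map_comp, h, CategoryTheory.Functor.map_id]) hM trivial

lemma addHull_single_zero {M : ModuleCat.{u} A} (hM : IsZero M) :
    addHull (IsSemisimpleQuotient A) ((singleFunctor (ModuleCat.{u} A) 0).obj M) :=
  addHull_single_of_retract (M := ModuleCat.of A (A ⧸ jrad A)) 0 0 (hM.eq_of_src _ _)
    (.of rfl trivial)

lemma addHull_single_pi (k : ℕ) : addHull (IsSemisimpleQuotient A)
    ((singleFunctor (ModuleCat.{u} A) 0).obj (ModuleCat.of A (Fin k → A ⧸ jrad A))) := by
  induction k with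
  | zero => exact addHull_single_zero (ModuleCat.isZero_of_subsingleton _)
  | succ k ih =>
    let F := singleFunctor (ModuleCat.{u} A) 0
    let R := A ⧸ jrad A
    let i₁ : ModuleCat.of A R ⟶ ModuleCat.of A (Fin (k + 1) → R) :=
      ModuleCat.ofHom (LinearMap.single A (fun _ ↦ R) 0)
    let i₂ : ModuleCat.of A (Fin k → R) ⟶ ModuleCat.of A (Fin (k + 1) → R) :=
      ModuleCat.ofHom (LinearMap.pi (Fin.cons 0 fun j ↦ LinearMap.proj j))
    let p₁ : ModuleCat.of A (Fin (k + 1) → R) ⟶ ModuleCat.of A R :=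
      ModuleCat.ofHom (LinearMap.proj 0)
    let p₂ : ModuleCat.of A (Fin (k + 1) → R) ⟶ ModuleCat.of A (Fin k → R) :=
      ModuleCat.ofHom (LinearMap.pi fun j ↦ LinearMap.proj j.succ)
    refine .sum (F.map i₁) (F.map i₂) (F.map p₁) (F.map p₂) ⟨?_, ?_, ?_⟩ (.of rfl trivial) ih
      trivial
    · rw [← Functor.map_comp, ← CategoryTheory.Functor.map_id]
      congr 1
    · rw [← Functor.map_comp, ← CategoryTheory.Functor.map_id]
      congr 1
    · rw [← Functor.map_comp, ← Functor.map_comp, ← Functor.map_add,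
        ← CategoryTheory.Functor.map_id]
      congr 1
      ext x j
      refine Fin.cases ?_ (fun j ↦ ?_) j <;> simp [i₁, i₂, p₁, p₂]

variable [IsArtinianRing A]

lemma addHull_single (M : ModuleCat.{u} A) [Module.Finite A M] (hM : IsRadTorsion A M) (n : ℤ) :
    addHull (IsSemisimpleQuotient A) ((singleFunctor (ModuleCat.{u} A) n).obj M) := by
  obtain ⟨k, i, p, h⟩ := hM.exists_retract
  have h₀ := addHull_single_of_retract (N := M) (ModuleCat.ofHom i) (ModuleCat.ofHom p)
    (ModuleCat.hom_ext h) (addHull_single_pi k)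
  exact (addHullIn.shift (-n) h₀ trivial).of_iso
    (((singleFunctors (ModuleCat.{u} A)).shiftIso (-n) n 0 (by lia)).app M) trivial

end Semisimple

section SplitComplexes

open DerivedCategory
open HomologicalComplex hiding homologyFunctor

lemma isIso_homologyMap_mkHomFromSingle {D : Type u} [Category.{v} D] [Abelian D]
    (K : CochainComplex D ℤ) (n : ℤ) (s : K.homology n ⟶ K.cycles n)
    (hs : s ≫ K.homologyπ n = 𝟙 _) :
    IsIso (homologyMap (mkHomFromSingle (s ≫ K.iCycles n) (fun k _ ↦ by simp) :
      (single D (ComplexShape.up ℤ) n).obj (K.homology n) ⟶ K) n) := by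
  set f : (single D (ComplexShape.up ℤ) n).obj (K.homology n) ⟶ K :=
    mkHomFromSingle (s ≫ K.iCycles n) (fun k _ ↦ by simp)
  have h₁ : (singleObjCyclesSelfIso (ComplexShape.up ℤ) n (K.homology n)).inv ≫
      cyclesMap f n = s := by
    simp [← cancel_mono (K.iCycles n), f]
  have h₂ : (singleObjHomologySelfIso (ComplexShape.up ℤ) n (K.homology n)).inv ≫
      homologyMap f n = 𝟙 _ := by
    rw [← singleObjCyclesSelfIso_inv_homologyπ, Category.assoc, homologyπ_naturality,
      reassoc_of% h₁, hs]
  rw [Iso.inv_comp_eq, Category.comp_id] at h₂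
  rw [h₂]
  infer_instance

lemma exists_single_hom {D : Type u} [Category.{v} D] [Abelian D] [HasDerivedCategory.{w} D]
    (K : CochainComplex D ℤ) (n : ℤ) (s : K.homology n ⟶ K.cycles n)
    (hs : s ≫ K.homologyπ n = 𝟙 _) :
    ∃ g : (singleFunctor D n).obj (K.homology n) ⟶ Q.obj K,
      IsIso ((homologyFunctor D n).map g) := by
  let f : (single D (ComplexShape.up ℤ) n).obj (K.homology n) ⟶ K :=
    mkHomFromSingle (s ≫ K.iCycles n) (fun k _ ↦ by simp)
  have hf : IsIso (homologyMap f n) := isIso_homologyMap_mkHomFromSingle K n s hs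
  refine ⟨((singleFunctorIsoCompQ D n).app _).hom ≫ Q.map f, ?_⟩
  have : IsIso ((homologyFunctor D n).map (Q.map f)) :=
    (NatIso.isIso_map_iff (homologyFunctorFactors D n) f).2 hf
  rw [Functor.map_comp]
  exact IsIso.comp_isIso' ((homologyFunctor D n).mapIso
    ((singleFunctorIsoCompQ D n).app (K.homology n))).isIso_hom this

variable {A : Type u} [Ring A] [HasDerivedCategory.{w} (ModuleCat.{u} A)]

lemma exists_hom_of_single_homs {X : DerivedCategory (ModuleCat.{u} A)}
    {M : ℤ → ModuleCat.{u} A}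
    (hM : ∀ n, addHull (IsSemisimpleQuotient A) ((singleFunctor _ n).obj (M n)))
    (g : ∀ n, (singleFunctor _ n).obj (M n) ⟶ X)
    (hg : ∀ n, IsIso ((homologyFunctor _ n).map (g n))) (s : Finset ℤ) :
    ∃ (Y : DerivedCategory (ModuleCat.{u} A)) (f : Y ⟶ X), addHull (IsSemisimpleQuotient A) Y ∧
      (∀ n ∈ s, IsIso ((homologyFunctor _ n).map f)) ∧
      ∀ n ∉ s, IsZero ((homologyFunctor _ n).obj Y) := by
  induction s using Finset.induction_on with
  | empty =>
    have h : IsZero (ModuleCat.of A PUnit.{u + 1}) := ModuleCat.isZero_of_subsingleton _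
    exact ⟨(singleFunctor _ 0).obj _, 0, addHull_single_zero h, by simp,
      fun n _ ↦ Functor.map_isZero _ (Functor.map_isZero _ h)⟩
  | insert m s hm ih =>
    obtain ⟨Y, f, hY, hf, hY₀⟩ := ih
    let Z := (singleFunctor _ m).obj (M m)
    let H := homologyFunctor (ModuleCat.{u} A)
    have hid (n : ℤ) : (H n).map (biprod.fst : Y ⊞ Z ⟶ Y) ≫ (H n).map biprod.inl +
        (H n).map (biprod.snd : Y ⊞ Z ⟶ Z) ≫ (H n).map biprod.inr = 𝟙 _ := by
      rw [← Functor.map_comp, ← Functor.map_comp, ← Functor.map_add, biprod.total,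
        CategoryTheory.Functor.map_id]
    refine ⟨Y ⊞ Z, biprod.desc f (g m),
      .sum biprod.inl biprod.inr biprod.fst biprod.snd ⟨by simp, by simp, by simp⟩
        hY (hM m) trivial, fun n hn ↦ ?_, fun n hn ↦ ?_⟩
    · rcases Finset.mem_insert.1 hn with rfl | hn
      · have h : (H n).map (biprod.desc f (g n)) = (H n).map biprod.snd ≫ (H n).map (g n) := by
          have := hid n
          rw [(hY₀ n hm).eq_of_tgt ((H n).map biprod.fst) 0, zero_comp, zero_add] at this
          rw [← Category.id_comp ((H n).map (biprod.desc f (g n))), ← this, Category.assoc,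
            ← (H n).map_comp biprod.inr, biprod.inr_desc]
        have : IsIso ((H n).map (biprod.snd : Y ⊞ Z ⟶ Z)) :=
          ⟨(H n).map biprod.inr, by
            have := hid n
            rwa [(hY₀ n hm).eq_of_tgt ((H n).map biprod.fst) 0, zero_comp, zero_add] at this,
            by rw [← Functor.map_comp, biprod.inr_snd, CategoryTheory.Functor.map_id]⟩
        have := hg n
        rw [h]
        infer_instance
      · have hnm : n ≠ m := fun h ↦ hm (h ▸ hn)
        have h₁ := hid n
        rw [(isZero_homology_single A (M m) hnm).eq_of_tgt ((H n).map biprod.snd) 0, zero_comp,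
          add_zero] at h₁
        have h : (H n).map (biprod.desc f (g m)) = (H n).map biprod.fst ≫ (H n).map f := by
          rw [← Category.id_comp ((H n).map (biprod.desc f (g m))), ← h₁, Category.assoc,
            ← (H n).map_comp biprod.inl, biprod.inl_desc]
        have : IsIso ((H n).map (biprod.fst : Y ⊞ Z ⟶ Y)) :=
          ⟨(H n).map biprod.inl, h₁, by
            rw [← Functor.map_comp, biprod.inl_fst, CategoryTheory.Functor.map_id]⟩
        have := hf n hn
        rw [h]
        infer_instance
    · rw [Finset.mem_insert, not_or] at hn
      rw [IsZero.iff_id_eq_zero, ← hid,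
        (isZero_homology_single A (M m) hn.1).eq_of_tgt ((H n).map biprod.snd) 0,
        (hY₀ n hn.2).eq_of_tgt ((H n).map biprod.fst) 0]
      simp

lemma addHull_of_isRadTorsion [IsArtinianRing A] (K : CochainComplex (ModuleCat.{u} A) ℤ)
    (hfin : ∀ n, Module.Finite A (K.X n)) (htors : ∀ n, IsRadTorsion A (K.X n))
    (a b : ℤ) (hab : ∀ n, n < a ∨ b < n → IsZero (K.X n)) :
    addHull (IsSemisimpleQuotient A) (Q.obj K) := by
  have hi (n : ℤ) : Function.Injective (K.iCycles n).hom :=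
    (ModuleCat.mono_iff_injective _).1 inferInstance
  have hπ (n : ℤ) : Function.Surjective (K.homologyπ n).hom :=
    (ModuleCat.epi_iff_surjective _).1 inferInstance
  have hc (n : ℤ) : IsRadTorsion A (K.cycles n) := (htors n).of_injective _ (hi n)
  have hc' (n : ℤ) : Module.Finite A (K.cycles n) :=
    Module.Finite.of_injective _ (hi n)
  have hh (n : ℤ) : IsRadTorsion A (K.homology n) := (hc n).of_surjective _ (hπ n)
  have hh' (n : ℤ) : Module.Finite A (K.homology n) :=
    Module.Finite.of_surjective _ (hπ n)
  have key (n : ℤ) : ∃ g : (singleFunctor (ModuleCat.{u} A) n).obj (K.homology n) ⟶ Q.obj K,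
      IsIso ((homologyFunctor _ n).map g) := by
    have := (hc n).isSemisimpleModule
    obtain ⟨s, hs⟩ := IsSemisimpleModule.lifting_property _ (hπ n) LinearMap.id
    exact exists_single_hom K n (ModuleCat.ofHom s) (ModuleCat.hom_ext hs)
  choose g hg using key
  obtain ⟨Y, f, hY, hf, hY₀⟩ := exists_hom_of_single_homs
    (fun n ↦ addHull_single (K.homology n) (hh n) n) g hg (Finset.Icc a b)
  have : IsIso f := by
    rw [isIso_iff]
    intro n
    by_cases hn : n ∈ Finset.Icc a b
    · exact hf n hn
    · have h₁ := hY₀ n hn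
      have h₂ : IsZero ((homologyFunctor _ n).obj (Q.obj K)) := by
        refine IsZero.of_iso ?_ ((homologyFunctorFactors _ n).app K)
        refine (exactAt_iff_isZero_homology K n).1 (ShortComplex.exact_of_isZero_X₂ _ (hab n ?_))
        rw [Finset.mem_Icc] at hn
        lia
      exact ⟨0, h₁.eq_of_src _ _, h₂.eq_of_src _ _⟩
  exact hY.of_iso (asIso f) trivial

end SplitComplexes

section Subcomplex

variable {A : Type u} [Ring A] {K : CochainComplex (ModuleCat.{u} A) ℤ}

/-- A family of submodules of the terms of a complex which is stable under the differential. -/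
def IsSubcomplex (L : ∀ n, Submodule A (K.X n)) : Prop :=
  ∀ i j, L i ≤ (L j).comap (K.d i j).hom

namespace IsSubcomplex

variable {L : ∀ n, Submodule A (K.X n)} (hL : IsSubcomplex L)

/-- The complex formed by a stable family of submodules. -/
def sub : CochainComplex (ModuleCat.{u} A) ℤ where
  X n := ModuleCat.of A (L n)
  d i j := ModuleCat.ofHom ((K.d i j).hom.restrict (hL i j))
  shape i j h := by
    ext x
    simp [K.shape i j h]
  d_comp_d' i j k _ _ := by
    ext x
    exact congr($(K.d_comp_d i j k).hom x.1)

/-- The quotient of a complex by a stable family of submodules. -/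
def quotient : CochainComplex (ModuleCat.{u} A) ℤ where
  X n := ModuleCat.of A (K.X n ⧸ L n)
  d i j := ModuleCat.ofHom ((L i).mapQ (L j) (K.d i j).hom (hL i j))
  shape i j h := by
    ext x
    simp [K.shape i j h]
  d_comp_d' i j k _ _ := by
    refine ModuleCat.hom_ext (Submodule.linearMap_qext _ (LinearMap.ext fun x ↦ ?_))
    exact congr((L k).mkQ ($(K.d_comp_d i j k).hom x))

/-- The short exact sequence attached to a stable family of submodules. -/
def shortComplex : ShortComplex (CochainComplex (ModuleCat.{u} A) ℤ) where
  X₁ := hL.sub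
  X₂ := K
  X₃ := hL.quotient
  f := { f n := ModuleCat.ofHom (L n).subtype }
  g := { f n := ModuleCat.ofHom (L n).mkQ }
  zero := by
    ext n x
    exact (Submodule.Quotient.mk_eq_zero (L n)).2 (Subtype.property x)

lemma shortExact : hL.shortComplex.ShortExact :=
  HomologicalComplex.shortExact_of_degreewise_shortExact _ fun n ↦
    { exact := by
        rw [ShortComplex.moduleCat_exact_iff]
        intro x hx
        exact ⟨⟨x, (Submodule.Quotient.mk_eq_zero _).1 hx⟩, rfl⟩
      mono_f := (ModuleCat.mono_iff_injective _).2 (L n).subtype_injective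
      epi_g := (ModuleCat.epi_iff_surjective _).2 (L n).mkQ_surjective }

end IsSubcomplex

end Subcomplex

section Filtration

open DerivedCategory

variable {A : Type u} [Ring A] [IsArtinianRing A] [HasDerivedCategory.{w} (ModuleCat.{u} A)]

lemma isZero_Q_obj {D : Type u} [Category.{v} D] [Abelian D] [HasDerivedCategory.{w} D]
    {K : CochainComplex D ℤ} (hK : ∀ n, K.ExactAt n) : IsZero (Q.obj K) := by
  have hH (n : ℤ) : IsZero ((homologyFunctor D n).obj (Q.obj K)) :=
    IsZero.of_iso ((HomologicalComplex.exactAt_iff_isZero_homology K n).1 (hK n))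
      ((homologyFunctorFactors D n).app K)
  have : IsIso (0 : Q.obj K ⟶ Q.obj K) := by
    rw [isIso_iff]
    exact fun n ↦ ⟨0, (hH n).eq_of_src _ _, (hH n).eq_of_src _ _⟩
  rw [IsZero.iff_id_eq_zero, ← IsIso.inv_hom_id (0 : Q.obj K ⟶ Q.obj K), comp_zero]

lemma hullStep_of_smul_eq_zero (a b : ℤ) (d : ℕ) (K : CochainComplex (ModuleCat.{u} A) ℤ)
    (hfin : ∀ n, Module.Finite A (K.X n)) (hab : ∀ n, n < a ∨ b < n → IsZero (K.X n))
    (hK : ∀ ℓ : List A, ℓ.length = d → (∀ x ∈ ℓ, x ∈ jrad A) →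
      ∀ (n : ℤ) (m : K.X n), ℓ.prod • m = 0) :
    hullStep (IsSemisimpleQuotient A) d (Q.obj K) := by
  induction d generalizing K with
  | zero =>
    refine ⟨isZero_Q_obj fun n ↦ ShortComplex.exact_of_isZero_X₂ _ ?_, trivial⟩
    have : Subsingleton (K.X n) := subsingleton_of_forall_eq 0 fun m ↦ by
      simpa using hK [] rfl (by simp) n m
    exact ModuleCat.isZero_of_subsingleton (K.X n)
  | succ d ih =>
    let L (n : ℤ) : Submodule A (K.X n) := jrad A • ⊤
    have hL : IsSubcomplex L := fun i j ↦ by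
      rw [Submodule.smul_le]
      intro r hr x _
      rw [Submodule.mem_comap, map_smul]
      exact Submodule.smul_mem_smul hr trivial
    have h₁ : hullStep (IsSemisimpleQuotient A) d (Q.obj hL.sub) := by
      refine ih hL.sub (fun n ↦ inferInstanceAs (Module.Finite A (L n))) (fun n hn ↦ ?_)
        fun ℓ hℓ hx n m ↦ ?_
      · have := ModuleCat.subsingleton_of_isZero (hab n hn)
        exact ModuleCat.isZero_of_subsingleton (ModuleCat.of A (L n))
      · obtain ⟨m, hm⟩ := m
        refine Subtype.ext (?_ : ℓ.prod • m = 0)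
        induction hm using Submodule.smul_induction_on' with
        | smul r hr y _ =>
          simpa [mul_smul] using hK (ℓ ++ [r]) (by simp [hℓ]) (by
            intro x hx'
            rw [List.mem_append, List.mem_singleton] at hx'
            exact hx'.elim (hx x) (· ▸ hr)) n y
        | add y _ z _ hy hz => rw [smul_add, hy, hz, add_zero]
    have h₂ : addHull (IsSemisimpleQuotient A) (Q.obj hL.quotient) := by
      refine addHull_of_isRadTorsion hL.quotient
        (fun n ↦ inferInstanceAs (Module.Finite A (K.X n ⧸ L n)))
        (fun n ↦ Module.isTorsionBySet_quotient_ideal_smul (K.X n) (jrad A)) a b fun n hn ↦ ?_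
      have := ModuleCat.subsingleton_of_isZero (hab n hn)
      exact ModuleCat.isZero_of_subsingleton (ModuleCat.of A (K.X n ⧸ L n))
    exact .of ⟨_, _, _, _, _, trivial, h₁, h₂, triangleOfSES_distinguished hL.shortExact⟩ trivial

end Filtration

section FiniteReplacement

open DerivedCategory

variable {A : Type u} [Ring A]

lemma exists_fg_map_eq {M N : Type*} [AddCommGroup M] [Module A M] [AddCommGroup N] [Module A N]
    (f : M →ₗ[A] N) {P : Submodule A N} (hP : P.FG) (h : P ≤ LinearMap.range f) :
    ∃ L : Submodule A M, L.FG ∧ L.map f = P := by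
  classical
  obtain ⟨s, rfl⟩ := hP
  have hs : (s : Set N) ⊆ f '' Set.univ := by
    rw [Set.image_univ]
    exact Submodule.span_le.1 h
  obtain ⟨t, -, rfl⟩ := Finset.subset_set_image_iff.1 hs
  exact ⟨Submodule.span A t, ⟨t, rfl⟩, by rw [Submodule.map_span, Finset.coe_image]⟩

lemma exists_fg_sup_range (S : ShortComplex (ModuleCat.{u} A)) (hS : Module.Finite A S.homology) :
    ∃ L : Submodule A S.X₂, L.FG ∧ L ≤ LinearMap.ker S.g.hom ∧
      LinearMap.ker S.g.hom ≤ L ⊔ LinearMap.range S.f.hom := by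
  have : Module.Finite A (LinearMap.ker S.g.hom ⧸ LinearMap.range S.moduleCatToCycles) :=
    Module.Finite.equiv S.moduleCatHomologyIso.toLinearEquiv
  obtain ⟨P, hP, hP'⟩ := exists_fg_map_eq (Submodule.mkQ (LinearMap.range S.moduleCatToCycles))
    (Module.Finite.fg_top (R := A)) (by rw [Submodule.range_mkQ])
  rw [Submodule.map_mkQ_eq_top] at hP'
  refine ⟨P.map (Submodule.subtype _), hP.map _, Submodule.map_subtype_le _ _, fun z hz ↦ ?_⟩
  obtain ⟨_, ⟨y, rfl⟩, p, hp, h⟩ := Submodule.mem_sup.1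
    (hP' ▸ Submodule.mem_top : (⟨z, hz⟩ : LinearMap.ker S.g.hom) ∈ _)
  exact Submodule.mem_sup.2 ⟨p, ⟨p, hp, rfl⟩, S.f.hom y, ⟨y, rfl⟩,
    (add_comm _ _).trans congr(($h : S.X₂))⟩

lemma exists_fg_lift [IsNoetherianRing A] (S : ShortComplex (ModuleCat.{u} A))
    (hS : Module.Finite A S.homology) (N : Submodule A S.X₃) (hN : N.FG) :
    ∃ L : Submodule A S.X₂, L.FG ∧ L ≤ N.comap S.g.hom ∧
      ∀ x, S.g.hom x ∈ N → ∃ y, x - S.f.hom y ∈ L := by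
  have : IsNoetherian A N := isNoetherian_of_fg_of_noetherian N hN
  obtain ⟨L₁, h₁, h₁'⟩ := exists_fg_map_eq S.g.hom (P := N ⊓ LinearMap.range S.g.hom)
    (Submodule.FG.of_le hN inf_le_left) inf_le_right
  obtain ⟨L₂, h₂, h₂', h₂''⟩ := exists_fg_sup_range S hS
  refine ⟨L₁ ⊔ L₂, h₁.sup h₂, sup_le ?_ ?_, fun x hx ↦ ?_⟩
  · rw [← Submodule.map_le_iff_le_comap, h₁']
    exact inf_le_left
  · exact h₂'.trans (Submodule.comap_mono bot_le)
  · obtain ⟨l, hl, h⟩ : S.g.hom x ∈ L₁.map S.g.hom := h₁' ▸ ⟨hx, x, rfl⟩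
    have hk : x - l ∈ LinearMap.ker S.g.hom := by rw [LinearMap.mem_ker, map_sub, h, sub_self]
    obtain ⟨l', hl', _, ⟨y, rfl⟩, h'⟩ := Submodule.mem_sup.1 (h₂'' hk)
    refine ⟨y, Submodule.mem_sup.2 ⟨l, hl, l', hl', ?_⟩⟩
    rw [eq_sub_of_add_eq h']
    abel

/-- Stability under the differential, with a lifting property in degrees at least `m`. -/
structure IsFiniteModel (K : CochainComplex (ModuleCat.{u} A) ℤ)
    (L : ∀ n, Submodule A (K.X n)) (m : ℤ) : Prop where
  fg (n : ℤ) : (L n).FG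
  isSubcomplex : IsSubcomplex L
  exists_sub_mem {i j k : ℤ} (hi : i + 1 = j) (hj : j + 1 = k) (hm : m ≤ j) (x : K.X j)
    (hx : (K.d j k).hom x ∈ L k) : ∃ y : K.X i, x - (K.d i j).hom y ∈ L j
  eq_bot (n : ℤ) (hn : n < m) : L n = ⊥

lemma exists_isFiniteModel [IsNoetherianRing A] (K : CochainComplex (ModuleCat.{u} A) ℤ)
    (hK : ∀ n, Module.Finite A (K.homology n)) (b : ℤ) (hb : ∀ n, b < n → IsZero (K.X n))
    (m : ℤ) (hm : m ≤ b + 1) : ∃ L, IsFiniteModel K L m := by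
  induction m, hm using Int.leInductionDown with
  | base =>
    refine ⟨fun _ ↦ ⊥, fun _ ↦ Submodule.fg_bot, fun _ _ ↦ bot_le, fun {i j k} _ _ hj x _ ↦ ?_,
      fun _ _ ↦ rfl⟩
    have := ModuleCat.subsingleton_of_isZero (hb j (by lia))
    exact ⟨0, Subsingleton.elim _ _⟩
  | pred m _ ih =>
    obtain ⟨L, hL⟩ := ih
    generalize hp : m - 1 = p
    obtain rfl : m = p + 1 := by lia
    obtain ⟨N, h₁, h₂, h₃⟩ : ∃ N : Submodule A (K.X p), N.FG ∧
        N ≤ (L (p + 1)).comap (K.d p (p + 1)).hom ∧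
        ∀ x, (K.d p (p + 1)).hom x ∈ L (p + 1) → ∃ y, x - (K.d (p - 1) p).hom y ∈ N :=
      exists_fg_lift (K.sc' (p - 1) p (p + 1))
        (have := hK p
        Module.Finite.equiv
          (K.homologyIsoSc' (p - 1) p (p + 1) (by simp) (by simp)).toLinearEquiv)
        (L (p + 1)) (hL.fg _)
    obtain ⟨L', rfl, h⟩ : ∃ L' : ∀ n, Submodule A (K.X n), L' p = N ∧ ∀ n ≠ p, L' n = L n :=
      ⟨Function.update L p N, Function.update_self .., fun n hn ↦ Function.update_of_ne hn ..⟩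
    rw [← h (p + 1) (by lia)] at h₂ h₃
    refine ⟨L', fun n ↦ ?_, fun i j ↦ ?_, fun {i j k} hi hj hm x hx ↦ ?_, fun n hn ↦ ?_⟩
    · rcases eq_or_ne n p with rfl | hn
      · exact h₁
      · rw [h n hn]
        exact hL.fg n
    · by_cases hij : i + 1 = j
      · subst hij
        rcases lt_trichotomy i p with hi | rfl | hi
        · rw [h i hi.ne, hL.eq_bot i (by lia)]
          exact bot_le
        · exact h₂
        · rw [h i hi.ne', h (i + 1) (by lia)]
          exact hL.isSubcomplex _ _
      · simp [K.shape i j hij]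
    · rcases eq_or_ne j p with rfl | hjp
      · obtain rfl : i = j - 1 := by lia
        subst hj
        exact h₃ x hx
      · rw [h j hjp]
        rw [h k (by lia)] at hx
        exact hL.exists_sub_mem hi hj (by lia) x hx
    · rw [h n (by lia)]
      exact hL.eq_bot n (by lia)

lemma IsFiniteModel.exactAt_quotient {K : CochainComplex (ModuleCat.{u} A) ℤ}
    {L : ∀ n, Submodule A (K.X n)} {a : ℤ} (hL : IsFiniteModel K L a)
    (ha : ∀ n, n < a → IsZero (K.X n)) (n : ℤ) : hL.isSubcomplex.quotient.ExactAt n := by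
  rw [HomologicalComplex.exactAt_iff' _ (n - 1) n (n + 1) (by simp) (by simp),
    ShortComplex.moduleCat_exact_iff]
  intro x hx
  obtain ⟨x, rfl⟩ := (L n).mkQ_surjective x
  have hx' : (K.d n (n + 1)).hom x ∈ L (n + 1) := (Submodule.Quotient.mk_eq_zero _).1 hx
  obtain ⟨y, hy⟩ : ∃ y, x - (K.d (n - 1) n).hom y ∈ L n := by
    rcases lt_or_ge n a with hn | hn
    · have := ModuleCat.subsingleton_of_isZero (ha n hn)
      exact ⟨0, by rw [Subsingleton.elim (x - _) 0]; exact zero_mem _⟩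
    · exact hL.exists_sub_mem (by lia) rfl hn x hx'
  exact ⟨(L (n - 1)).mkQ y, ((Submodule.Quotient.eq _).2 hy).symm⟩

variable [HasDerivedCategory.{w} (ModuleCat.{u} A)]

lemma exists_iso_Q_obj_finite [IsNoetherianRing A] {X : DerivedCategory (ModuleCat.{u} A)}
    (hX : DbFgObj A X) :
    ∃ (K : CochainComplex (ModuleCat.{u} A) ℤ) (a b : ℤ), (∀ n, Module.Finite A (K.X n)) ∧
      (∀ n, n < a ∨ b < n → IsZero (K.X n)) ∧ Nonempty (Q.obj K ≅ X) := by
  obtain ⟨⟨a, b, hab⟩, hfin⟩ := hX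
  have : X.IsGE a := (isGE_iff X a).2 fun n hn ↦ hab n (.inl hn)
  have : X.IsLE b := (isLE_iff X b).2 fun n hn ↦ hab n (.inr hn)
  obtain ⟨K, _, _, ⟨e⟩⟩ := exists_iso_Q_obj_of_isGE_of_isLE X a b
  have ha (n : ℤ) (hn : n < a) : IsZero (K.X n) := K.isZero_of_isStrictlyGE a n hn
  have hb (n : ℤ) (hn : b < n) : IsZero (K.X n) := K.isZero_of_isStrictlyLE b n hn
  have hK (n : ℤ) : Module.Finite A (K.homology n) :=
    have := hfin n
    Module.Finite.equiv ((homologyFunctor _ n).mapIso e ≪≫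
      (homologyFunctorFactors _ n).app K).toLinearEquiv
  obtain ⟨L, hL⟩ := exists_isFiniteModel K hK (max a b) (fun n hn ↦ hb n (by lia)) a (by lia)
  refine ⟨hL.isSubcomplex.sub, a, b, fun n ↦ Module.Finite.iff_fg.2 (hL.fg n), fun n hn ↦ ?_, ?_⟩
  · have := ModuleCat.subsingleton_of_isZero (hn.elim (ha n) (hb n))
    exact ModuleCat.isZero_of_subsingleton (ModuleCat.of A (L n))
  · have h := triangleOfSES_distinguished hL.isSubcomplex.shortExact
    have : IsIso (Q.map hL.isSubcomplex.shortComplex.f) :=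
      (Triangle.isZero₃_iff_isIso₁ _ h).1 (isZero_Q_obj (hL.exactAt_quotient ha))
    let e' := asIso (Q.map hL.isSubcomplex.shortComplex.f)
    exact ⟨e' ≪≫ e.symm⟩

end FiniteReplacement

section

variable {A : Type u} [Ring A]

lemma LoewyVanish.list_prod_eq_zero {i : ℕ} (h : LoewyVanish A i) (ℓ : List A)
    (hℓ : ℓ.length = i) (hx : ∀ x ∈ ℓ, x ∈ jrad A) : ℓ.prod = 0 := by
  subst hℓ
  simpa using h ℓ.get fun j ↦ hx _ (ℓ.get_mem j)

lemma LoewyVanish.succ {i : ℕ} (h : LoewyVanish A i) : LoewyVanish A (i + 1) := fun x hx ↦ by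
  rw [List.ofFn_succ, List.prod_cons, h _ fun j ↦ hx j.succ, mul_zero]

variable [IsArtinianRing A] [HasDerivedCategory.{w} (ModuleCat.{u} A)]

lemma LoewyVanish.hullStep_of_dbFgObj {i : ℕ} (h : LoewyVanish A i)
    {X : DerivedCategory (ModuleCat.{u} A)} (hX : DbFgObj A X) :
    hullStep (IsSemisimpleQuotient A) i X := by
  obtain ⟨K, a, b, hfin, hab, ⟨e⟩⟩ := exists_iso_Q_obj_finite hX
  have hK := hullStep_of_smul_eq_zero a b i K hfin hab fun ℓ hℓ hx n m ↦ by
    rw [h.list_prod_eq_zero ℓ hℓ hx, zero_smul]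
  cases i with
  | zero => exact ⟨hK.1.of_iso e.symm, trivial⟩
  | succ i => exact addHullIn.of_iso hK e trivial

lemma hullStepIn_and_dbFgObj_of_hullStep {d : ℕ} {X : DerivedCategory (ModuleCat.{u} A)}
    (hX : hullStep (IsSemisimpleQuotient A) d X) :
    hullStepIn (DbFgObj A) (IsSemisimpleQuotient A) d X ∧ DbFgObj A X :=
  (isThickClass_dbFgObj A).hullStepIn_of_hullStep (by rintro _ rfl; exact dbFgObj_single A _ 0) d hX

end

/-- **Rouquier, Proposition 5.41.** Let `A` be an artinian ring with Jacobson radical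
`J(A)` and Loewy length `l` (the smallest `i` with `J(A)^i = 0`). Then
`D^b(A-mod) = ⟨A/J(A)⟩_l` ; in particular, the dimension of the bounded derived category
of finitely generated `A`-modules is at most `l - 1`. -/
theorem bounded_derived_category_eq_hull_semisimple_quotient
    (A : Type u) [Ring A] [IsArtinianRing A]
    [HasDerivedCategory.{w} (ModuleCat.{u} A)]
    (l : ℕ) (hl : IsLeast {i : ℕ | LoewyVanish A i} l) :
    (∀ X : DerivedCategory (ModuleCat.{u} A),
      DbFgObj A X ↔ hullStep (fun Y => Y =
        (DerivedCategory.singleFunctor (ModuleCat.{u} A) 0).obj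
          (ModuleCat.of A (A ⧸ jrad A))) l X) ∧
    subDim (DbFgObj A) ≤ ((l - 1 : ℕ) : ℕ∞) := by
  refine ⟨fun X ↦ ⟨hl.1.hullStep_of_dbFgObj, fun hX ↦ (hullStepIn_and_dbFgObj_of_hullStep hX).2⟩,
    iInf₂_le (l - 1) ⟨_, dbFgObj_single A (ModuleCat.of A (A ⧸ jrad A)) 0, fun X ↦
      ⟨fun hX ↦ (hullStepIn_and_dbFgObj_of_hullStep (LoewyVanish.hullStep_of_dbFgObj ?_ hX)).1,
        hullStepIn_le _⟩⟩⟩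
  have h : LoewyVanish A l := hl.1
  cases l with
  | zero => exact h.succ
  | succ l => exact h

end Rouquier
end

section
/- Let F: T → T' be a triangulated functor between triangulated categories whose image is dense (every object of T' is a direct summand of an object in the image). If T = ⟨I⟩_d for a subcategory I and d ∈ ℕ ∪ {∞}, then T' = ⟨F(I)⟩_d. Consequently dim T' ≤ dim T; in particular, for any thick subcategory I of T, dim (T/I) ≤ dim T. -/
open CategoryTheory CategoryTheory.Limits CategoryTheory.Pretriangulated

universe w v u v' u'

namespace Rouquier

section

variable {C : Type u} [Category.{v} C] [HasZeroObject C] [Preadditive C]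
  [HasShift C ℤ] [∀ n : ℤ, (shiftFunctor C n).Additive] [Pretriangulated C]
  {D : Type u'} [Category.{v'} D] [HasZeroObject D] [Preadditive D]
  [HasShift D ℤ] [∀ n : ℤ, (shiftFunctor D n).Additive] [Pretriangulated D]
  (F : C ⥤ D) [F.CommShift ℤ] [F.IsTriangulated]

lemma IsDirSum.map {X Y Z : C} {i₁ : X ⟶ Z} {i₂ : Y ⟶ Z} {p₁ : Z ⟶ X} {p₂ : Z ⟶ Y}
    (h : IsDirSum i₁ i₂ p₁ p₂) :
    IsDirSum (F.map i₁) (F.map i₂) (F.map p₁) (F.map p₂) := by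
  obtain ⟨h₁, h₂, h₃⟩ := h
  refine ⟨?_, ?_, ?_⟩
  · rw [← F.map_comp, h₁, F.map_id]
  · rw [← F.map_comp, h₂, F.map_id]
  · rw [← F.map_comp, ← F.map_comp, ← F.map_add, h₃, F.map_id]

lemma addHull.map {I : C → Prop} {J : D → Prop} (hIJ : ∀ X, I X → J (F.obj X)) {X : C}
    (hX : addHull I X) : addHull J (F.obj X) := by
  induction hX with
  | of h _ => exact .of (hIJ _ h) trivial
  | shift n _ _ ih =>
    exact .smd ((F.commShiftIso n).hom.app _) ((F.commShiftIso n).inv.app _)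
      (Iso.hom_inv_id_app _ _) (.shift n ih trivial) trivial
  | sum i₁ i₂ p₁ p₂ h _ _ _ ih₁ ih₂ => exact .sum _ _ _ _ (h.map F) ih₁ ih₂ trivial
  | smd i p h _ _ ih =>
    exact .smd (F.map i) (F.map p) (by rw [← F.map_comp, h, F.map_id]) ih trivial

lemma star.map {I₁ I₂ : C → Prop} {J₁ J₂ : D → Prop} (h₁ : ∀ X, I₁ X → J₁ (F.obj X))
    (h₂ : ∀ X, I₂ X → J₂ (F.obj X)) {X : C} (hX : star I₁ I₂ X) :
    star J₁ J₂ (F.obj X) := by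
  obtain ⟨X₁, X₂, f, g, h, -, hX₁, hX₂, hT⟩ := hX
  exact ⟨_, _, _, _, _, trivial, h₁ _ hX₁, h₂ _ hX₂, F.map_distinguished _ hT⟩

lemma hullStep.map {I : C → Prop} {J : D → Prop} (hIJ : ∀ X, I X → J (F.obj X)) (d : ℕ)
    {X : C} (hX : hullStep I d X) : hullStep J d (F.obj X) := by
  induction d generalizing X with
  | zero => exact ⟨F.map_isZero hX.1, trivial⟩
  | succ d ih =>
    exact addHull.map F (fun _ h ↦ star.map F (fun _ ↦ ih) (fun _ ↦ addHull.map F hIJ) h) hX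

lemma hullStep.of_retract {I : C → Prop} (d : ℕ) {X Y : C} (i : Y ⟶ X) (p : X ⟶ Y)
    (h : i ≫ p = 𝟙 Y) (hX : hullStep I d X) : hullStep I d Y := by
  cases d with
  | zero =>
    exact ⟨(IsZero.iff_id_eq_zero _).2 (by rw [← h, hX.1.eq_of_tgt i 0, zero_comp]), trivial⟩
  | succ d => exact .smd i p h hX trivial

end

/-- **Rouquier, Lemma 3.3.** Let `F : T ⥤ T'` be a triangulated functor between
triangulated categories whose image is dense (every object of `T'` is a direct summand
of an object in the image). If `T = ⟨I⟩_d` for a subcategory `I` and `d ∈ ℕ ∪ {∞}`,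
then `T' = ⟨F(I)⟩_d` ; consequently `dim T' ≤ dim T`. -/
theorem hull_image_of_dense_and_dim_le
    {C : Type u} [Category.{v} C] [HasZeroObject C] [Preadditive C]
    [HasShift C ℤ] [∀ n : ℤ, (shiftFunctor C n).Additive] [Pretriangulated C]
    {D : Type u'} [Category.{v'} D] [HasZeroObject D] [Preadditive D]
    [HasShift D ℤ] [∀ n : ℤ, (shiftFunctor D n).Additive] [Pretriangulated D]
    (F : C ⥤ D) [F.CommShift ℤ] [F.IsTriangulated]
    (hdense : ∀ Y : D, ∃ (X : C) (i : Y ⟶ F.obj X) (p : F.obj X ⟶ Y), i ≫ p = 𝟙 Y) :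
    (∀ (I : C → Prop) (d : ℕ∞), (∀ X : C, hullE I d X) →
      ∀ Y : D, hullE (fun Z => ∃ X : C, I X ∧ Nonempty (Z ≅ F.obj X)) d Y) ∧
    trDim D ≤ trDim C := by
  have key {I : C → Prop} {J : D → Prop} (hIJ : ∀ X, I X → J (F.obj X)) (d : ℕ) (Y : D)
      (hI : ∀ X, hullStep I d X) : hullStep J d Y := by
    obtain ⟨X, i, p, h⟩ := hdense Y
    exact .of_retract d i p h (.map F hIJ d (hI X))
  refine ⟨fun I d hI Y ↦ ?_, le_iInf₂ fun d ⟨M, hM⟩ ↦ iInf₂_le d ?_⟩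
  · have hIJ (X : C) (hX : I X) : ∃ X' : C, I X' ∧ Nonempty (F.obj X ≅ F.obj X') :=
      ⟨X, hX, ⟨Iso.refl _⟩⟩
    induction d using ENat.recTopCoe with
    | top =>
      obtain ⟨X, i, p, h⟩ := hdense Y
      obtain ⟨d, hd⟩ := hI X
      exact ⟨d, .of_retract d i p h (.map F hIJ d hd)⟩
    | coe d => exact key hIJ d Y hI
  · exact ⟨F.obj M, fun Y ↦
      key (I := (· = M)) (J := (· = F.obj M)) (fun _ h ↦ congrArg F.obj h) (d + 1) Y hM⟩

end Rouquier
end
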